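/- arXiv:1005.2661 — 10 statements merged into one kernel-verified Lean document; each statement's English description precedes it below -/
import Mathlib

section
/- Let α ∈ (0,1] and let g : S → ℝ be nonnegative and α-excessive. Then for every stopping time τ and every x ∈ S one has E_x[α^τ g(X_τ)] ≤ g(x). -/
open MeasureTheory

/-- `τ` is a stopping time w.r.t. the natural filtration of the coordinate process
`X_n(ω) = ω n`: the event `{τ = n}` depends only on the coordinates `0,…,n`
(which, for a discrete state space, is equivalent to `F_n`-measurability), and `τ`
is a.s. finite under every law `ℙ x`. -/
def IsStopTime {S : Type*} [MeasurableSpace S] (ℙ : S → Measure (ℕ → S))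
    (τ : (ℕ → S) → ℕ∞) : Prop :=
  (∀ (n : ℕ) (ω ω' : ℕ → S), (∀ i ≤ n, ω i = ω' i) → τ ω = (n : ℕ∞) → τ ω' = (n : ℕ∞)) ∧
  (∀ x, ℙ x {ω | τ ω ≠ ⊤} = 1)

theorem cylMeas {S : Type*} [Fintype S] [MeasurableSpace S] [MeasurableSingletonClass S]
    (n : ℕ) (path : ℕ → S) : MeasurableSet {ω : ℕ → S | ∀ i ≤ n, ω i = path i} := by
  have : {ω : ℕ → S | ∀ i ≤ n, ω i = path i} = ⋂ i, ⋂ (_ : i ≤ n), (fun ω : ℕ → S => ω i) ⁻¹' {path i} := by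
    ext ω; simp
  rw [this]
  exact MeasurableSet.iInter fun i => MeasurableSet.iInter fun _ =>
    measurable_pi_apply i (measurableSet_singleton _)

open Classical in
/-- truncated payoff -/
noncomputable def truncPay {S : Type*} (α : ℝ) (g : S → ℝ) (τ : (ℕ → S) → ℕ∞) (N : ℕ)
    (ω : ℕ → S) : ENNReal :=
  if τ ω ≤ N then ENNReal.ofReal (α ^ (τ ω).toNat * g (ω (τ ω).toNat)) else 0

theorem truncPay_congr {S : Type*} (α : ℝ) (g : S → ℝ) (τ : (ℕ → S) → ℕ∞)
    (hτ : ∀ (n : ℕ) (ω ω' : ℕ → S), (∀ i ≤ n, ω i = ω' i) → τ ω = (n : ℕ∞) → τ ω' = (n : ℕ∞))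
    (N : ℕ) (ω ω' : ℕ → S) (h : ∀ i ≤ N, ω i = ω' i) :
    truncPay α g τ N ω = truncPay α g τ N ω' := by
  have key : ∀ ω ω' : ℕ → S, (∀ i ≤ N, ω i = ω' i) → τ ω ≤ N → τ ω' = τ ω := by
    intro ω ω' h h1
    obtain ⟨m, hm⟩ := ENat.ne_top_iff_exists.1 (ne_top_of_le_ne_top (ENat.coe_ne_top N) h1)
    rw [← hm] at h1 ⊢
    have h2 : m ≤ N := by exact_mod_cast h1
    exact hτ m ω ω' (fun i hi => h i (hi.trans h2)) hm.symm
  unfold truncPay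
  by_cases h1 : τ ω ≤ N
  · have h2 := key ω ω' h h1
    rw [h2, if_pos h1, if_pos h1]
    rw [h]
    exact ENat.toNat_le_of_le_coe h1
  · have h2 : ¬ τ ω' ≤ N := fun h3 => by
      have := key ω' ω (fun i hi => (h i hi).symm) h3
      exact h1 (this ▸ h3)
    rw [if_neg h1, if_neg h2]

theorem truncPay_meas {S : Type*} [Fintype S] [MeasurableSpace S] [MeasurableSingletonClass S]
    (α : ℝ) (g : S → ℝ) (τ : (ℕ → S) → ℕ∞)
    (hτ : ∀ (n : ℕ) (ω ω' : ℕ → S), (∀ i ≤ n, ω i = ω' i) → τ ω = (n : ℕ∞) → τ ω' = (n : ℕ∞))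
    (N : ℕ) (x : S) : Measurable (truncPay α g τ N) := by
  let ext : (Fin (N+1) → S) → (ℕ → S) := fun r i => if h : i < N + 1 then r ⟨i, h⟩ else x
  let res : (ℕ → S) → (Fin (N+1) → S) := fun ω i => ω i
  have h1 : truncPay α g τ N = (truncPay α g τ N ∘ ext) ∘ res := by
    funext ω
    refine truncPay_congr α g τ hτ N _ _ fun i hi => ?_
    simp [ext, res]
    omega
  rw [h1]
  refine Measurable.comp (measurable_of_finite _) ?_
  exact measurable_pi_lambda _ fun i => measurable_pi_apply _

theorem truncPay_cyl {S : Type*} [Fintype S] [DecidableEq S] [MeasurableSpace S] [MeasurableSingletonClass S]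
    (P : S → S → ℝ) (hP0 : ∀ x y, 0 ≤ P x y)
    (μ : Measure (ℕ → S)) (x : S)
    (hMarkov : ∀ (n : ℕ) (path : ℕ → S),
      μ {ω | ∀ i ≤ n, ω i = path i}
        = ENNReal.ofReal ((if path 0 = x then (1:ℝ) else 0) *
            ∏ i ∈ Finset.range n, P (path i) (path (i + 1))))
    (α : ℝ) (hα : 0 < α) (g : S → ℝ) (hg : ∀ x, 0 ≤ g x)
    (hexc : ∀ x, α * ∑ y, P x y * g y ≤ g x)
    (τ : (ℕ → S) → ℕ∞)
    (hτ : ∀ (n : ℕ) (ω ω' : ℕ → S), (∀ i ≤ n, ω i = ω' i) → τ ω = (n : ℕ∞) → τ ω' = (n : ℕ∞))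
    (k : ℕ) : ∀ (n : ℕ) (path : ℕ → S), (∀ ω, (∀ i ≤ n, ω i = path i) → (n : ℕ∞) ≤ τ ω) →
      ∫⁻ ω in {ω | ∀ i ≤ n, ω i = path i}, truncPay α g τ (n + k) ω ∂μ
        ≤ ENNReal.ofReal (α ^ n * g (path n)) * μ {ω | ∀ i ≤ n, ω i = path i} := by
  have stopped : ∀ (k n : ℕ) (path : ℕ → S), τ path = n →
      ∫⁻ ω in {ω | ∀ i ≤ n, ω i = path i}, truncPay α g τ (n + k) ω ∂μ
        ≤ ENNReal.ofReal (α ^ n * g (path n)) * μ {ω | ∀ i ≤ n, ω i = path i} := by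
    intro k n path hp
    rw [← setLIntegral_const]
    refine setLIntegral_mono' (cylMeas n path) fun ω hω => ?_
    have h1 : τ ω = n := hτ n path ω (fun i hi => (hω i hi).symm) hp
    unfold truncPay
    rw [h1]
    split_ifs
    · simp [hω n le_rfl]
    · exact zero_le
  have later : ∀ (n : ℕ) (path : ℕ → S), (∀ ω, (∀ i ≤ n, ω i = path i) → (n : ℕ∞) ≤ τ ω) →
      τ path ≠ n → ∀ ω, (∀ i ≤ n, ω i = path i) → ((n + 1 : ℕ) : ℕ∞) ≤ τ ω := by
    intro n path h hp ω hω
    have h1 := h ω hω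
    have h2 : (n : ℕ∞) ≠ τ ω := fun h3 => hp (hτ n ω path hω h3.symm)
    have h3 := lt_of_le_of_ne h1 h2
    push_cast
    exact Order.add_one_le_of_lt h3
  induction k with
  | zero =>
    intro n path h
    by_cases hp : τ path = n
    · exact stopped 0 n path hp
    · have h0 : ∫⁻ ω in {ω | ∀ i ≤ n, ω i = path i}, truncPay α g τ (n + 0) ω ∂μ
          ≤ ∫⁻ ω in {ω | ∀ i ≤ n, ω i = path i}, 0 ∂μ := by
        refine setLIntegral_mono' (cylMeas n path) fun ω hω => ?_
        have h1 := later n path h hp ω hω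
        have h2 : ¬ τ ω ≤ ((n + 0 : ℕ) : ℕ∞) := fun h3 => by
          have := h1.trans h3
          have : n + 1 ≤ n + 0 := by exact_mod_cast this
          omega
        unfold truncPay
        rw [if_neg h2]
      refine h0.trans ?_
      simp
  | succ k ih =>
    intro n path h
    by_cases hp : τ path = n
    · exact stopped (k+1) n path hp
    · have hup : ∀ y, ∀ i ≤ n, Function.update path (n+1) y i = path i := by
        intro y i hi
        rw [Function.update_of_ne (by omega)]
      have hU : {ω : ℕ → S | ∀ i ≤ n, ω i = path i} ⊆
          ⋃ y, {ω : ℕ → S | ∀ i ≤ n+1, ω i = Function.update path (n+1) y i} := by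
        intro ω hω
        refine Set.mem_iUnion.2 ⟨ω (n+1), fun i hi => ?_⟩
        rcases Nat.lt_or_ge n i with h1 | h1
        · obtain rfl : i = n + 1 := by omega
          simp
        · rw [hup _ i h1]; exact hω i h1
      refine (lintegral_mono_set hU).trans ((lintegral_iUnion_le _ _).trans ?_)
      rw [tsum_fintype]
      have hstep : ∀ y, ∫⁻ ω in {ω | ∀ i ≤ n+1, ω i = Function.update path (n+1) y i},
          truncPay α g τ (n + (k+1)) ω ∂μ ≤ ENNReal.ofReal (α ^ (n+1) * g y) *
            (μ {ω | ∀ i ≤ n, ω i = path i} * ENNReal.ofReal (P (path n) y)) := by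
        intro y
        have h1 := ih (n+1) (Function.update path (n+1) y) (fun ω hω =>
          later n path h hp ω fun i hi => (hω i (by omega)).trans (hup y i hi))
        rw [show n + 1 + k = n + (k+1) by omega] at h1
        refine h1.trans (le_of_eq ?_)
        rw [hMarkov, hMarkov, Finset.prod_range_succ, hup y 0 (by omega), hup y n le_rfl,
          Function.update_self]
        have h2 : ∏ i ∈ Finset.range n, P (Function.update path (n+1) y i)
            (Function.update path (n+1) y (i+1)) =
            ∏ i ∈ Finset.range n, P (path i) (path (i+1)) :=
          Finset.prod_congr rfl fun i hi => by
            have := Finset.mem_range.1 hi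
            rw [hup y i (by omega), hup y (i+1) (by omega)]
        rw [h2, ← mul_assoc, ENNReal.ofReal_mul' (hP0 _ _)]
      refine (Finset.sum_le_sum fun y _ => hstep y).trans ?_
      have h3 : ∀ y, ENNReal.ofReal (α ^ (n+1) * g y) *
            (μ {ω | ∀ i ≤ n, ω i = path i} * ENNReal.ofReal (P (path n) y)) =
          ENNReal.ofReal (α ^ (n+1) * g y * P (path n) y) * μ {ω | ∀ i ≤ n, ω i = path i} := by
        intro y
        rw [ENNReal.ofReal_mul' (hP0 _ _)]; ring
      simp_rw [h3]
      rw [← Finset.sum_mul, ← ENNReal.ofReal_sum_of_nonneg (fun y _ =>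
        mul_nonneg (mul_nonneg (pow_nonneg hα.le _) (hg y)) (hP0 _ _))]
      gcongr
      have h4 : ∑ y, α ^ (n+1) * g y * P (path n) y = α ^ n * (α * ∑ y, P (path n) y * g y) := by
        simp_rw [Finset.mul_sum]
        exact Finset.sum_congr rfl fun y _ => by ring
      rw [h4]
      exact mul_le_mul_of_nonneg_left (hexc _) (pow_nonneg hα.le _)

/-- if `α ∈ (0,1]` and `g` is a nonnegative `α`-excessive function
(`g(x) ≥ α (P g)(x)` for all `x`), then for every stopping time `τ` and every
starting state `x`, `E_x[α^τ g(X_τ)] ≤ g(x)`.  Here `ℙ x` is the law of the Markov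
chain with (stochastic) transition matrix `P` started at `x`, characterized by its
finite-dimensional (cylinder) distributions. -/
theorem stmt0 {S : Type*} [Fintype S] [DecidableEq S] [MeasurableSpace S] [MeasurableSingletonClass S]
    (P : S → S → ℝ) (hP0 : ∀ x y, 0 ≤ P x y) (hP1 : ∀ x, ∑ y, P x y = 1)
    (ℙ : S → Measure (ℕ → S)) (hprob : ∀ x, IsProbabilityMeasure (ℙ x))
    (hMarkov : ∀ (x : S) (n : ℕ) (path : ℕ → S),
      ℙ x {ω | ∀ i ≤ n, ω i = path i}
        = ENNReal.ofReal ((if path 0 = x then (1:ℝ) else 0) *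
            ∏ i ∈ Finset.range n, P (path i) (path (i + 1))))
    (α : ℝ) (hα : α ∈ Set.Ioc (0:ℝ) 1)
    (g : S → ℝ) (hg : ∀ x, 0 ≤ g x)
    (hexc : ∀ x, α * ∑ y, P x y * g y ≤ g x)
    (τ : (ℕ → S) → ℕ∞) (hτ : IsStopTime ℙ τ) (x : S) :
    ∫ ω, α ^ (τ ω).toNat * g (ω (τ ω).toNat) ∂(ℙ x) ≤ g x := by
  haveI := hprob x
  have hN : ∀ N, ∫⁻ ω, truncPay α g τ N ω ∂(ℙ x) ≤ ENNReal.ofReal (g x) := by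
    intro N
    have h1 := truncPay_cyl P hP0 (ℙ x) x (hMarkov x) α hα.1 g hg hexc τ hτ.1 N 0 (fun _ => x)
      (fun ω _ => by simp)
    have h2 : ℙ x {ω | ∀ i ≤ 0, ω i = x} = 1 := by
      have := hMarkov x 0 (fun _ => x)
      simpa using this
    have h3 : (ℙ x).restrict {ω | ∀ i ≤ 0, ω i = x} = ℙ x := by
      rw [Measure.restrict_eq_self_of_ae_mem]
      exact (mem_ae_iff_prob_eq_one (cylMeas 0 (fun _ => x))).2 h2
    rw [h3, h2] at h1
    simpa using h1
  have hmono : Monotone (truncPay α g τ) := by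
    intro M N hMN ω
    unfold truncPay
    by_cases h1 : τ ω ≤ M
    · have h2 : τ ω ≤ N := h1.trans (by exact_mod_cast hMN)
      rw [if_pos h1, if_pos h2]
    · rw [if_neg h1]; exact zero_le
  have hsup : ∫⁻ ω, ⨆ N, truncPay α g τ N ω ∂(ℙ x) ≤ ENNReal.ofReal (g x) := by
    rw [lintegral_iSup (fun N => truncPay_meas α g τ hτ.1 N x) hmono]
    exact iSup_le hN
  have hfin : ∀ᵐ ω ∂(ℙ x), τ ω ≠ ⊤ := by
    have hm : MeasurableSet {ω | τ ω ≠ ⊤} := by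
      have : {ω | τ ω ≠ ⊤} = ⋃ N : ℕ, {ω | truncPay 1 (fun _ : S => 1) τ N ω = 1} := by
        ext ω
        simp only [Set.mem_setOf_eq, Set.mem_iUnion]
        constructor
        · intro h
          refine ⟨(τ ω).toNat, ?_⟩
          unfold truncPay
          rw [if_pos (by rw [ENat.coe_toNat h])]
          simp
        · rintro ⟨N, h⟩ h1
          unfold truncPay at h
          simp [h1] at h
      rw [this]
      exact MeasurableSet.iUnion fun N =>
        truncPay_meas 1 (fun _ : S => 1) τ hτ.1 N x (measurableSet_singleton 1)
    exact (mem_ae_iff_prob_eq_one hm).2 (hτ.2 x)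
  by_cases hint : Integrable (fun ω => α ^ (τ ω).toNat * g (ω (τ ω).toNat)) (ℙ x)
  · rw [← ENNReal.ofReal_le_ofReal_iff (hg x), ofReal_integral_eq_lintegral_ofReal hint
      (Filter.Eventually.of_forall fun ω => mul_nonneg (pow_nonneg hα.1.le _) (hg _))]
    refine le_trans (lintegral_mono_ae ?_) hsup
    filter_upwards [hfin] with ω h
    refine le_trans ?_ (le_iSup _ (τ ω).toNat)
    unfold truncPay
    rw [if_pos (by rw [ENat.coe_toNat h])]
  · rw [integral_undef hint]; exact hg x
end

section
/- Let α ∈ (0,1) and let g : S → ℝ be nonnegative and α-excessive, and set h := g − α(P g) (so h ≥ 0 pointwise). Then for every x ∈ S the series Σ_{n=0}^∞ α^n (Pⁿ h)(x) converges and equals g(x). -/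
theorem aux_bounds {S : Type*} [Fintype S] [DecidableEq S]
    (P : Matrix S S ℝ) (hP0 : ∀ x y, 0 ≤ P x y) (hP1 : ∀ x, ∑ y, P x y = 1)
    (f : S → ℝ) (C : ℝ) (h0 : ∀ y, 0 ≤ f y) (hC : ∀ y, f y ≤ C) (n : ℕ) :
    ∀ x, 0 ≤ (P ^ n).mulVec f x ∧ (P ^ n).mulVec f x ≤ C := by
  induction n with
  | zero => intro x; simpa using ⟨h0 x, hC x⟩
  | succ k ih =>
    intro x
    rw [pow_succ', ← Matrix.mulVec_mulVec]
    refine ⟨Finset.sum_nonneg fun y _ => mul_nonneg (hP0 x y) (ih y).1, ?_⟩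
    calc ∑ y, P x y * (P ^ k).mulVec f y ≤ ∑ y, P x y * C :=
          Finset.sum_le_sum fun y _ => mul_le_mul_of_nonneg_left (ih y).2 (hP0 x y)
      _ = C := by rw [← Finset.sum_mul, hP1, one_mul]

/-- for `α ∈ (0,1)` and a nonnegative `α`-excessive function `g`
(`g(x) ≥ α (P g)(x)` for all `x`), setting `h := g - α (P g) ≥ 0`, the series
`Σ_{n=0}^∞ α^n (Pⁿ h)(x)` converges to `g(x)` for every `x`.  Here `P` is a
stochastic matrix on the finite state space `S` acting on functions by
`(P g)(x) = Σ_y P x y * g y`, i.e. `P.mulVec g`. -/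
theorem stmt1 {S : Type*} [Fintype S] [DecidableEq S]
    (P : Matrix S S ℝ) (hP0 : ∀ x y, 0 ≤ P x y) (hP1 : ∀ x, ∑ y, P x y = 1)
    (α : ℝ) (hα : α ∈ Set.Ioo (0:ℝ) 1)
    (g : S → ℝ) (hg : ∀ x, 0 ≤ g x)
    (hexc : ∀ x, α * P.mulVec g x ≤ g x)
    (x : S) :
    HasSum (fun n : ℕ => α ^ n * (P ^ n).mulVec (g - α • P.mulVec g) x) (g x) := by
  obtain ⟨ha0, ha1⟩ := hα
  have bound : ∀ f : S → ℝ, (∀ y, 0 ≤ f y) → ∀ n x,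
      0 ≤ (P ^ n).mulVec f x ∧ (P ^ n).mulVec f x ≤ ∑ y, f y := fun f hf n =>
    aux_bounds P hP0 hP1 f _ hf
      (fun y => Finset.single_le_sum (fun i _ => hf i) (Finset.mem_univ y)) n
  have hh : ∀ y, 0 ≤ (g - α • P.mulVec g) y := fun y => by
    simpa using hexc y
  rw [hasSum_iff_tendsto_nat_of_nonneg
    (fun n => mul_nonneg (pow_nonneg ha0.le n) (bound _ hh n x).1)]
  have hs : ∀ N : ℕ, ∑ n ∈ Finset.range N, α ^ n * (P ^ n).mulVec (g - α • P.mulVec g) x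
      = g x - α ^ N * (P ^ N).mulVec g x := by
    intro N
    induction N with
    | zero => simp
    | succ k ih =>
      rw [Finset.sum_range_succ, ih, Matrix.mulVec_sub, Matrix.mulVec_smul,
        Matrix.mulVec_mulVec, ← pow_succ]
      simp only [Pi.sub_apply, Pi.smul_apply, smul_eq_mul]
      ring
  simp only [hs]
  have hz : Filter.Tendsto (fun N : ℕ => α ^ N * (P ^ N).mulVec g x) Filter.atTop (nhds 0) := by
    refine squeeze_zero (g := fun N : ℕ => α ^ N * ∑ y, g y)
      (fun n => mul_nonneg (pow_nonneg ha0.le n) (bound g hg n x).1)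
      (fun n => mul_le_mul_of_nonneg_left (bound g hg n x).2 (pow_nonneg ha0.le n)) ?_
    simpa using (tendsto_pow_atTop_nhds_zero_of_lt_one ha0.le ha1).mul_const (∑ y, g y)
  simpa using hz.const_sub (g x)
end

section
/- Let α ∈ (0,1] and f : S → ℝ nonnegative, and let V(x) = sup over stopping times τ of E_x[α^τ f(X_τ)]. Then V is the smallest α-excessive majorant of f: V is α-excessive, V(x) ≥ f(x) for all x, and every α-excessive function g with g ≥ f pointwise satisfies g(x) ≥ V(x) for all x ∈ S. -/
open MeasureTheory

/-- The expected discounted reward `E_x[α^τ f(X_τ)]` obtained by stopping at `τ`. -/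
noncomputable def reward {S : Type*} [MeasurableSpace S] (ℙ : S → Measure (ℕ → S))
    (α : ℝ) (f : S → ℝ) (τ : (ℕ → S) → ℕ∞) (x : S) : ℝ :=
  ∫ ω, α ^ (τ ω).toNat * f (ω (τ ω).toNat) ∂(ℙ x)

/-- The price of the optimal stopping problem:
`V(x) = sup over stopping times τ of E_x[α^τ f(X_τ)]`. -/
noncomputable def price {S : Type*} [MeasurableSpace S] (ℙ : S → Measure (ℕ → S))
    (α : ℝ) (f : S → ℝ) (x : S) : ℝ :=
  ⨆ τ : {τ : (ℕ → S) → ℕ∞ // IsStopTime ℙ τ}, reward ℙ α f τ.1 x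


set_option linter.unusedSectionVars false

namespace OptStop

variable {S : Type*}

/-- Prepend a state to a trajectory. -/
def cs (x : S) (ω : ℕ → S) : ℕ → S
  | 0 => x
  | k + 1 => ω k

@[simp] lemma cs_zero (x : S) (ω : ℕ → S) : cs x ω 0 = x := rfl
@[simp] lemma cs_succ (x : S) (ω : ℕ → S) (k : ℕ) : cs x ω (k + 1) = ω k := rfl

/-- Cylinder set. -/
def cyl (n : ℕ) (p : ℕ → S) : Set (ℕ → S) := {ω | ∀ i ≤ n, ω i = p i}

/-- Adaptedness part of being a stopping time. -/
def Ad (τ : (ℕ → S) → ℕ∞) : Prop :=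
  ∀ (n : ℕ) (ω ω' : ℕ → S), (∀ i ≤ n, ω i = ω' i) → τ ω = (n : ℕ∞) → τ ω' = (n : ℕ∞)

lemma meas_of_cyl [Finite S] (m : MeasurableSpace (ℕ → S))
    (hm : ∀ n p, MeasurableSet[m] (cyl (S := S) n p)) (n : ℕ) (s : Set (ℕ → S))
    (hs : ∀ ω ω', (∀ i ≤ n, ω i = ω' i) → ω ∈ s → ω' ∈ s) : MeasurableSet[m] s := by
  classical
  let r : (ℕ → S) → (Fin (n + 1) → S) := fun ω i => ω i
  have hr : ∀ ω ω', r ω = r ω' ↔ ∀ i ≤ n, ω i = ω' i := by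
    intro ω ω'
    constructor
    · intro h i hi
      exact congrFun h ⟨i, by omega⟩
    · intro h
      funext i
      exact h i (by omega)
  have : s = ⋃ p ∈ r '' s, r ⁻¹' {p} := by
    ext ω
    simp only [Set.mem_iUnion, Set.mem_preimage, Set.mem_singleton_iff, exists_prop]
    constructor
    · intro h
      exact ⟨r ω, ⟨ω, h, rfl⟩, rfl⟩
    · rintro ⟨p, ⟨ω', h, rfl⟩, h2⟩
      exact hs ω' ω ((hr _ _).1 h2.symm) h
  rw [this]
  refine MeasurableSet.biUnion (Set.toFinite _).countable ?_
  rintro p ⟨ω, -, rfl⟩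
  have : r ⁻¹' {r ω} = cyl n ω := by
    ext ω'
    simp only [Set.mem_preimage, Set.mem_singleton_iff, hr]
    rfl
  rw [this]
  exact hm n ω

variable [MeasurableSpace S] [MeasurableSingletonClass S]

lemma meas_cyl (n : ℕ) (p : ℕ → S) : MeasurableSet (cyl n p) := by
  have : cyl n p = ⋂ i, ⋂ (_ : i ≤ n), (fun ω : ℕ → S => ω i) ⁻¹' {p i} := by
    ext ω; simp [cyl]
  rw [this]
  exact MeasurableSet.iInter fun i => MeasurableSet.iInter fun _ =>
    (measurable_pi_apply i) (measurableSet_singleton _)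

lemma meas_cs (x : S) : Measurable (cs x) := by
  refine measurable_pi_lambda _ fun n => ?_
  cases n with
  | zero => exact measurable_const
  | succ k => exact measurable_pi_apply k

lemma gen [Finite S] : (MeasurableSpace.pi : MeasurableSpace (ℕ → S)) =
    MeasurableSpace.generateFrom {s | ∃ n p, s = cyl n p} := by
  apply le_antisymm
  · refine iSup_le fun i => ?_
    rintro _ ⟨t, -, rfl⟩
    refine meas_of_cyl _ (fun n p => MeasurableSpace.measurableSet_generateFrom
      (Set.mem_setOf.2 ⟨n, p, rfl⟩)) i _ ?_
    intro ω ω' h h1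
    simp only [Set.mem_preimage] at h1 ⊢
    rwa [← h i le_rfl]
  · refine MeasurableSpace.generateFrom_le ?_
    rintro _ ⟨n, p, rfl⟩
    exact meas_cyl n p

lemma piSys : IsPiSystem {s : Set (ℕ → S) | ∃ n p, s = cyl n p} := by
  rintro _ ⟨n, p, rfl⟩ _ ⟨m, q, rfl⟩ ⟨ω, h1, h2⟩
  refine ⟨max n m, ω, ?_⟩
  ext ω'
  constructor
  · rintro ⟨h3, h4⟩ i hi
    rcases le_max_iff.1 hi with h | h
    · rw [h3 i h, h1 i h]
    · rw [h4 i h, h2 i h]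
  · intro h
    exact ⟨fun i hi => (h i (le_max_of_le_left hi)).trans (h1 i hi),
      fun i hi => (h i (le_max_of_le_right hi)).trans (h2 i hi)⟩

lemma meas_tau [Finite S] {τ : (ℕ → S) → ℕ∞} (h : Ad τ) (k : ℕ∞) : MeasurableSet {ω | τ ω = k} := by
  have h1 : ∀ n : ℕ, MeasurableSet {ω | τ ω = (n : ℕ∞)} := fun n =>
    meas_of_cyl _ meas_cyl n _ (fun ω ω' hh h2 => h n ω ω' hh h2)
  induction k using ENat.recTopCoe with
  | coe n => exact h1 n
  | top =>
    have : {ω | τ ω = ⊤} = (⋃ n : ℕ, {ω | τ ω = (n : ℕ∞)})ᶜ := by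
      ext ω
      simp only [Set.mem_ofPred_eq, Set.mem_compl_iff, Set.mem_iUnion, not_exists]
      constructor
      · intro h n; rw [h]; simp
      · intro h
        by_contra h2
        obtain ⟨n, hn⟩ := ENat.ne_top_iff_exists.1 h2
        exact h n hn.symm
    rw [this]
    exact (MeasurableSet.iUnion h1).compl

lemma meas_comp [Finite S] {τ : (ℕ → S) → ℕ∞} (h : Ad τ) (G : ℕ∞ → (ℕ → S) → ℝ)
    (hG : ∀ k, Measurable (G k)) : Measurable fun ω => G (τ ω) ω := by
  intro s hs
  have : (fun ω => G (τ ω) ω) ⁻¹' s = ⋃ k : ℕ∞, {ω | τ ω = k} ∩ G k ⁻¹' s := by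
    ext ω; simp
  rw [this]
  exact MeasurableSet.iUnion fun k => (meas_tau h k).inter (hG k hs)

lemma meas_f [Finite S] (f : S → ℝ) (k : ℕ) : Measurable fun ω : ℕ → S => f (ω k) :=
  (measurable_of_finite f).comp (measurable_pi_apply k)

lemma meas_pay [Finite S] {τ : (ℕ → S) → ℕ∞} (h : Ad τ) (α : ℝ) (f : S → ℝ) :
    Measurable fun ω => α ^ (τ ω).toNat * f (ω (τ ω).toNat) :=
  meas_comp h (fun k ω => α ^ k.toNat * f (ω k.toNat)) fun _ => (meas_f f _).const_mul _

/-- payoff truncated at time `n` -/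
noncomputable def tr (α : ℝ) (f : S → ℝ) (τ : (ℕ → S) → ℕ∞) (n : ℕ) (ω : ℕ → S) : ℝ :=
  if τ ω ≤ n then α ^ (τ ω).toNat * f (ω (τ ω).toNat) else 0

lemma meas_tr [Finite S] {τ : (ℕ → S) → ℕ∞} (h : Ad τ) (α : ℝ) (f : S → ℝ) (n : ℕ) :
    Measurable (tr α f τ n) := by
  refine meas_comp h (fun k ω => if k ≤ n then α ^ k.toNat * f (ω k.toNat) else 0) fun k => ?_
  by_cases hk : k ≤ n
  · simp only [hk, if_true]; exact (meas_f f _).const_mul _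
  · simp only [hk, if_false]; exact measurable_const

lemma bd_pay [Fintype S] {α : ℝ} (hα : α ∈ Set.Ioc (0:ℝ) 1) {f : S → ℝ} (hf : ∀ x, 0 ≤ f x)
    (k : ℕ) (y : S) : |α ^ k * f y| ≤ ∑ z, f z := by
  rw [abs_of_nonneg (mul_nonneg (pow_nonneg hα.1.le _) (hf y))]
  calc α ^ k * f y ≤ 1 * f y := by
        gcongr
        · exact hf y
        · exact pow_le_one₀ hα.1.le hα.2
    _ = f y := one_mul _
    _ ≤ _ := Finset.single_le_sum (fun z _ => hf z) (Finset.mem_univ y)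

lemma bd_tr [Fintype S] {α : ℝ} (hα : α ∈ Set.Ioc (0:ℝ) 1) {f : S → ℝ} (hf : ∀ x, 0 ≤ f x)
    (τ : (ℕ → S) → ℕ∞) (n : ℕ) (ω : ℕ → S) : |tr α f τ n ω| ≤ ∑ z, f z := by
  unfold tr
  split_ifs
  · exact bd_pay hα hf _ _
  · simpa using Finset.sum_nonneg fun z _ => hf z

/-- The law of the chain, as in the statement. -/
structure Law [Fintype S] [DecidableEq S] (P : S → S → ℝ) (ℙ : S → Measure (ℕ → S)) : Prop where
  hP0 : ∀ x y, 0 ≤ P x y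
  hP1 : ∀ x, ∑ y, P x y = 1
  hprob : ∀ x, IsProbabilityMeasure (ℙ x)
  hM : ∀ (x : S) (n : ℕ) (path : ℕ → S),
      ℙ x {ω | ∀ i ≤ n, ω i = path i}
        = ENNReal.ofReal ((if path 0 = x then (1:ℝ) else 0) *
            ∏ i ∈ Finset.range n, P (path i) (path (i + 1)))

variable [Fintype S] [DecidableEq S] {P : S → S → ℝ} {ℙ : S → Measure (ℕ → S)}

lemma Law.decomp (L : Law P ℙ) (x : S) :
    ℙ x = ∑ y, ENNReal.ofReal (P x y) • (ℙ y).map (cs x) := by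
  have := L.hprob
  have hs : ∑ y, ENNReal.ofReal (P x y) = 1 := by
    rw [← ENNReal.ofReal_sum_of_nonneg fun y _ => L.hP0 x y, L.hP1, ENNReal.ofReal_one]
  have hmap : ∀ y, IsProbabilityMeasure ((ℙ y).map (cs x)) := fun y =>
    Measure.isProbabilityMeasure_map (meas_cs x).aemeasurable
  refine ext_of_generate_finite _ gen piSys ?_ ?_
  · rintro _ ⟨n, p, rfl⟩
    simp only [Measure.coe_finsetSum, Finset.sum_apply, Measure.smul_apply, smul_eq_mul]
    simp only [Measure.map_apply (meas_cs x) (meas_cyl n p)]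
    refine (L.hM x n p).trans ?_
    by_cases h0 : p 0 = x
    · cases n with
      | zero =>
        have : cs x ⁻¹' cyl 0 p = Set.univ := by
          ext ω; simp [cyl, h0]
        simp [this, h0, hs]
      | succ k =>
        have : cs x ⁻¹' cyl (k + 1) p = {ω | ∀ i ≤ k, ω i = p (i + 1)} := by
          ext ω
          simp only [cyl, Set.mem_preimage, Set.mem_ofPred_eq]
          constructor
          · intro h i hi
            exact h (i + 1) (by omega)
          · intro h i hi
            cases i with
            | zero => exact h0.symm
            | succ i => exact h i (by omega)
        simp only [this, L.hM _ k (fun i => p (i + 1))]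
        rw [Finset.sum_eq_single (p 1)]
        · rw [← ENNReal.ofReal_mul (L.hP0 _ _), Finset.prod_range_succ']
          simp [h0, mul_comm]
        · intro b _ hb
          simp [hb.symm]
        · simp
    · have : cs x ⁻¹' cyl n p = ∅ := by
        ext ω
        simp only [cyl, Set.mem_preimage, Set.mem_ofPred_eq, Set.mem_empty_iff_false, iff_false]
        intro h
        exact h0 (h 0 (Nat.zero_le _)).symm
      simp [this, h0]
  · simp [hs]

lemma Law.step (L : Law P ℙ) (x : S) {h : (ℕ → S) → ℝ} (hm : Measurable h) {C : ℝ}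
    (hC : ∀ ω, |h ω| ≤ C) : ∫ ω, h ω ∂(ℙ x) = ∑ y, P x y * ∫ ω, h (cs x ω) ∂(ℙ y) := by
  have := L.hprob
  have hmap : ∀ y, IsProbabilityMeasure ((ℙ y).map (cs x)) := fun y =>
    Measure.isProbabilityMeasure_map (meas_cs x).aemeasurable
  have hi : ∀ y, Integrable h ((ℙ y).map (cs x)) := fun y =>
    Integrable.of_bound hm.aestronglyMeasurable C (Filter.Eventually.of_forall hC)
  conv_lhs => rw [L.decomp x]
  rw [integral_finsetSum_measure fun y _ => (hi y).smul_measure ENNReal.ofReal_ne_top]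
  refine Finset.sum_congr rfl fun y _ => ?_
  rw [integral_smul_measure, integral_map (meas_cs x).aemeasurable hm.aestronglyMeasurable,
    ENNReal.toReal_ofReal (L.hP0 x y), smul_eq_mul]

lemma Law.start (L : Law P ℙ) (x : S) : ∀ᵐ ω ∂(ℙ x), ω 0 = x := by
  have := L.hprob x
  have h := L.hM x 0 (fun _ => x)
  simp only [Nat.le_zero, forall_eq] at h
  have hm : MeasurableSet {ω : ℕ → S | ω 0 = x} :=
    measurableSet_preimage (t := {x}) (measurable_pi_apply 0) (measurableSet_singleton x)
  refine (mem_ae_iff_prob_eq_one hm).2 ?_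
  simpa using h

lemma Law.trunc (L : Law P ℙ) {α : ℝ} (hα : α ∈ Set.Ioc (0:ℝ) 1) {f : S → ℝ} (hf : ∀ x, 0 ≤ f x)
    {g : S → ℝ} (hg : ∀ x, α * ∑ y, P x y * g y ≤ g x) (hfg : ∀ x, f x ≤ g x) (n : ℕ) :
    ∀ (τ : (ℕ → S) → ℕ∞), Ad τ → ∀ x, ∫ ω, tr α f τ n ω ∂(ℙ x) ≤ g x := by
  have := L.hprob
  induction n with
  | zero =>
    intro τ hτ x
    rw [L.step x (meas_tr hτ α f 0) (bd_tr hα hf τ 0)]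
    calc _ ≤ ∑ y, P x y * g x := by
          refine Finset.sum_le_sum fun y _ => mul_le_mul_of_nonneg_left ?_ (L.hP0 x y)
          have hle : ∀ ω, tr α f τ 0 (cs x ω) ≤ g x := by
            intro ω
            unfold tr
            split_ifs with h
            · have h0 : τ (cs x ω) = 0 := by simpa using h
              simpa [h0] using hfg x
            · exact (hf x).trans (hfg x)
          calc _ ≤ ∫ ω, g x ∂(ℙ y) := by
                refine integral_mono ?_ (integrable_const _) hle
                exact Integrable.of_bound
                  ((meas_tr hτ α f 0).comp (meas_cs x)).aestronglyMeasurable (∑ z, f z)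
                  (Filter.Eventually.of_forall fun ω => bd_tr hα hf τ 0 (cs x ω))
            _ = g x := by simp
      _ = g x := by rw [← Finset.sum_mul, L.hP1, one_mul]
  | succ n ih =>
    intro τ hτ x
    rw [L.step x (meas_tr hτ α f _) (bd_tr hα hf τ _)]
    by_cases h0 : ∃ ω, τ (cs x ω) = 0
    · obtain ⟨ω₀, h0⟩ := h0
      have hz : ∀ ω, τ (cs x ω) = 0 := fun ω =>
        hτ 0 (cs x ω₀) _ (by intro i hi; obtain rfl : i = 0 := by omega
                             rfl) h0
      have : ∀ ω, tr α f τ (n + 1) (cs x ω) = f x := by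
        intro ω
        simp [tr, hz]
      simp only [this]
      simp only [integral_const, probReal_univ, one_smul]
      rw [← Finset.sum_mul, L.hP1, one_mul]
      exact hfg x
    · push Not at h0
      have key : ∀ ω, ∀ k : ℕ, τ (cs x ω) - 1 = k ↔ τ (cs x ω) = (k + 1 : ℕ) := by
        intro ω k
        have := h0 ω
        generalize τ (cs x ω) = t at *
        induction t using ENat.recTopCoe with
        | top =>
          have h5 : (⊤ : ℕ∞) ≠ ((k + 1 : ℕ) : ℕ∞) := (ENat.coe_ne_top _).symm
          have h6 : (⊤ : ℕ∞) - 1 ≠ (k : ℕ∞) := by simp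
          exact ⟨fun h => (h6 h).elim, fun h => (h5 h).elim⟩
        | coe m =>
          have hm : m ≠ 0 := by simpa using this
          norm_cast
          omega
      have hτ' : Ad (fun ω => τ (cs x ω) - 1) := by
        intro k ω ω' h h1
        rw [key] at h1 ⊢
        refine hτ _ (cs x ω) _ ?_ h1
        intro i hi
        cases i with
        | zero => rfl
        | succ i => exact h i (by omega)
      have heq : ∀ ω, tr α f τ (n + 1) (cs x ω) = α * tr α f (fun ω => τ (cs x ω) - 1) n ω := by
        intro ω
        have := h0 ω
        unfold tr
        simp only
        generalize τ (cs x ω) = t at *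
        induction t using ENat.recTopCoe with
        | top => simp
        | coe m =>
          obtain ⟨m, rfl⟩ : ∃ k, m = k + 1 := Nat.exists_eq_succ_of_ne_zero (by simpa using this)
          have h1 : (((m + 1 : ℕ) : ℕ∞) - 1) = (m : ℕ∞) := by norm_cast
          have h2 : (((m + 1 : ℕ) : ℕ∞) ≤ ((n + 1 : ℕ) : ℕ∞)) ↔ ((m : ℕ∞) ≤ (n : ℕ∞)) := by
            norm_cast; omega
          rw [h1]
          simp only [h2, ENat.toNat_natCast, cs_succ]
          split_ifs
          · ring
          · simp
      simp only [heq, integral_const_mul]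
      refine le_trans ?_ (hg x)
      rw [Finset.mul_sum]
      refine Finset.sum_le_sum fun y _ => ?_
      have := mul_le_mul_of_nonneg_left (ih _ hτ' y) (mul_nonneg hα.1.le (L.hP0 x y))
      linarith

lemma Law.upper (L : Law P ℙ) {α : ℝ} (hα : α ∈ Set.Ioc (0:ℝ) 1) {f : S → ℝ} (hf : ∀ x, 0 ≤ f x)
    {g : S → ℝ} (hg : ∀ x, α * ∑ y, P x y * g y ≤ g x) (hfg : ∀ x, f x ≤ g x)
    {τ : (ℕ → S) → ℕ∞} (hτ : IsStopTime ℙ τ) (x : S) : reward ℙ α f τ x ≤ g x := by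
  have := L.hprob
  have hA : Ad τ := hτ.1
  have hfin : ∀ᵐ ω ∂(ℙ x), τ ω ≠ ⊤ :=
    (mem_ae_iff_prob_eq_one (meas_tau hA ⊤).compl).2 (hτ.2 x)
  have : Filter.Tendsto (fun n => ∫ ω, tr α f τ n ω ∂(ℙ x)) Filter.atTop
      (nhds (reward ℙ α f τ x)) := by
    refine tendsto_integral_of_dominated_convergence (fun _ => ∑ z, f z)
      (fun n => (meas_tr hA α f n).aestronglyMeasurable) (integrable_const _)
      (fun n => Filter.Eventually.of_forall (bd_tr hα hf τ n)) ?_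
    filter_upwards [hfin] with ω hω
    obtain ⟨m, hm⟩ := ENat.ne_top_iff_exists.1 hω
    refine tendsto_const_nhds.congr' ?_
    filter_upwards [Filter.eventually_ge_atTop m] with n hn
    unfold tr
    rw [if_pos]
    rw [← hm]
    exact_mod_cast hn
  exact le_of_tendsto' this fun n => L.trunc hα hf hg hfg n τ hA x

lemma Law.bdd (L : Law P ℙ) {α : ℝ} (hα : α ∈ Set.Ioc (0:ℝ) 1) {f : S → ℝ} (hf : ∀ x, 0 ≤ f x)
    (x : S) : BddAbove (Set.range fun τ : {τ : (ℕ → S) → ℕ∞ // IsStopTime ℙ τ} =>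
      reward ℙ α f τ.1 x) := by
  refine ⟨∑ z, f z, ?_⟩
  rintro _ ⟨τ, rfl⟩
  refine L.upper hα hf (g := fun _ => ∑ z, f z) ?_ ?_ τ.2 x
  · intro x
    rw [← Finset.sum_mul, L.hP1, one_mul]
    exact mul_le_of_le_one_left (Finset.sum_nonneg fun z _ => hf z) hα.2
  · intro x
    exact Finset.single_le_sum (fun z _ => hf z) (Finset.mem_univ x)

lemma Law.zeroStop (L : Law P ℙ) : IsStopTime ℙ (fun _ => 0) := by
  have := L.hprob
  refine ⟨fun n ω ω' _ h => h, fun x => ?_⟩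
  simp

/-- Wait one step, then use the rule `σ y`, where `y` is the state at time one. -/
noncomputable def nxt (σ : S → (ℕ → S) → ℕ∞) (ω : ℕ → S) : ℕ∞ :=
  σ (ω 1) (fun n => ω (n + 1)) + 1

lemma Law.nxtStop (L : Law P ℙ) {σ : S → (ℕ → S) → ℕ∞} (hσ : ∀ y, IsStopTime ℙ (σ y)) :
    IsStopTime ℙ (nxt σ) := by
  have := L.hprob
  have hA : Ad (nxt σ) := by
    intro n ω ω' h h1
    unfold nxt at h1 ⊢
    cases n with
    | zero => simp at h1
    | succ n =>
      have h2 : σ (ω 1) (fun n => ω (n + 1)) = n := by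
        push_cast at h1
        generalize σ (ω 1) (fun n => ω (n + 1)) = t at h1 ⊢
        induction t using ENat.recTopCoe with
        | top => exact absurd h1 (ENat.coe_ne_top (n + 1)).symm
        | coe m => norm_cast at h1 ⊢; omega
      have h3 := (hσ (ω 1)).1 n _ (fun n => ω' (n + 1)) (fun i hi => h (i + 1) (by omega)) h2
      rw [← h 1 (by omega), h3]
      simp
  refine ⟨hA, fun x => ?_⟩
  have hmeas : MeasurableSet {ω | nxt σ ω ≠ ⊤} := (meas_tau hA ⊤).compl
  have hs : ∑ y, ENNReal.ofReal (P x y) = 1 := by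
    rw [← ENNReal.ofReal_sum_of_nonneg fun y _ => L.hP0 x y, L.hP1, ENNReal.ofReal_one]
  rw [L.decomp x]
  simp only [Measure.coe_finsetSum, Finset.sum_apply, Measure.smul_apply, smul_eq_mul]
  rw [← hs]
  refine Finset.sum_congr rfl fun y _ => ?_
  rw [Measure.map_apply (meas_cs x) hmeas]
  have h1 : ∀ᵐ ω ∂(ℙ y), σ y ω ≠ ⊤ :=
    (mem_ae_iff_prob_eq_one (meas_tau (hσ y).1 ⊤).compl).2 ((hσ y).2 y)
  have h2 : ∀ᵐ ω ∂(ℙ y), ω ∈ cs x ⁻¹' {ω | nxt σ ω ≠ ⊤} := by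
    filter_upwards [h1, L.start y] with ω ha hb
    simp only [Set.mem_preimage, Set.mem_ofPred_eq, nxt]
    change σ (ω 0) (fun n => ω n) + 1 ≠ ⊤
    rw [hb]
    simpa using ha
  rw [(mem_ae_iff_prob_eq_one ((meas_cs x) hmeas)).1 h2, mul_one]

lemma Law.nxtReward (L : Law P ℙ) {α : ℝ} (hα : α ∈ Set.Ioc (0:ℝ) 1) {f : S → ℝ}
    (hf : ∀ x, 0 ≤ f x) {σ : S → (ℕ → S) → ℕ∞} (hσ : ∀ y, IsStopTime ℙ (σ y)) (x : S) :
    reward ℙ α f (nxt σ) x = α * ∑ y, P x y * reward ℙ α f (σ y) y := by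
  unfold reward
  rw [L.step x (meas_pay (L.nxtStop hσ).1 α f) (fun ω => bd_pay hα hf _ _), Finset.mul_sum]
  refine Finset.sum_congr rfl fun y _ => ?_
  have := L.hprob
  rw [mul_left_comm, ← integral_const_mul α]
  congr 1
  refine integral_congr_ae ?_
  have h1 : ∀ᵐ ω ∂(ℙ y), σ y ω ≠ ⊤ :=
    (mem_ae_iff_prob_eq_one (meas_tau (hσ y).1 ⊤).compl).2 ((hσ y).2 y)
  filter_upwards [h1, L.start y] with ω ha hb
  have h3 : nxt σ (cs x ω) = σ y ω + 1 := by
    change σ (ω 0) (fun n => ω n) + 1 = _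
    rw [hb]
  obtain ⟨m, hm⟩ := ENat.ne_top_iff_exists.1 ha
  have h4 : (nxt σ (cs x ω)).toNat = m + 1 := by
    rw [h3, ← hm]; rfl
  rw [h4, ← hm, ENat.toNat_natCast, cs_succ]
  ring

end OptStop

/-- for `α ∈ (0,1]` and nonnegative `f`, the price
`V(x) = sup_τ E_x[α^τ f(X_τ)]` is the smallest `α`-excessive majorant of `f`:
`V` is `α`-excessive (`V(x) ≥ α (P V)(x)`), `V ≥ f` pointwise, and any
`α`-excessive `g ≥ f` satisfies `g ≥ V` pointwise.  Here `ℙ x` is the law of the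
Markov chain with stochastic transition matrix `P` started at `x`, characterized
by its finite-dimensional (cylinder) distributions. -/
theorem stmt3 {S : Type*} [Fintype S] [DecidableEq S] [MeasurableSpace S]
    [MeasurableSingletonClass S]
    (P : S → S → ℝ) (hP0 : ∀ x y, 0 ≤ P x y) (hP1 : ∀ x, ∑ y, P x y = 1)
    (ℙ : S → Measure (ℕ → S)) (hprob : ∀ x, IsProbabilityMeasure (ℙ x))
    (hMarkov : ∀ (x : S) (n : ℕ) (path : ℕ → S),
      ℙ x {ω | ∀ i ≤ n, ω i = path i}
        = ENNReal.ofReal ((if path 0 = x then (1:ℝ) else 0) *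
            ∏ i ∈ Finset.range n, P (path i) (path (i + 1))))
    (α : ℝ) (hα : α ∈ Set.Ioc (0:ℝ) 1)
    (f : S → ℝ) (hf : ∀ x, 0 ≤ f x) :
    (∀ x, α * ∑ y, P x y * price ℙ α f y ≤ price ℙ α f x) ∧
    (∀ x, f x ≤ price ℙ α f x) ∧
    (∀ g : S → ℝ, (∀ x, α * ∑ y, P x y * g y ≤ g x) → (∀ x, f x ≤ g x) →
      ∀ x, price ℙ α f x ≤ g x) := by
  have L : OptStop.Law P ℙ := ⟨hP0, hP1, hprob, hMarkov⟩
  have hle : ∀ τ, IsStopTime ℙ τ → ∀ x, reward ℙ α f τ x ≤ price ℙ α f x := fun τ hτ x =>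
    le_ciSup (L.bdd hα hf x) ⟨τ, hτ⟩
  have hne : Nonempty {τ : (ℕ → S) → ℕ∞ // IsStopTime ℙ τ} := ⟨⟨_, L.zeroStop⟩⟩
  refine ⟨fun x => ?_, fun x => ?_, fun g hg hfg x => ?_⟩
  · refine le_of_forall_pos_le_add fun ε hε => ?_
    have hex : ∀ y, ∃ τ, IsStopTime ℙ τ ∧ price ℙ α f y - ε < reward ℙ α f τ y := by
      intro y
      obtain ⟨τ, h⟩ := exists_lt_of_lt_ciSup (sub_lt_self (price ℙ α f y) hε)
      exact ⟨τ.1, τ.2, h⟩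
    choose σ hσ hσ2 using hex
    have h1 := hle _ (L.nxtStop hσ) x
    rw [L.nxtReward hα hf hσ x] at h1
    have h2 : ∑ y, P x y * price ℙ α f y ≤ ∑ y, P x y * reward ℙ α f (σ y) y + ε := by
      have : ε = ∑ y, P x y * ε := by rw [← Finset.sum_mul, hP1, one_mul]
      rw [this, ← Finset.sum_add_distrib]
      refine Finset.sum_le_sum fun y _ => ?_
      rw [← mul_add]
      exact mul_le_mul_of_nonneg_left (by linarith [hσ2 y]) (hP0 x y)
    have h3 := mul_le_mul_of_nonneg_left h2 hα.1.le
    have h4 : α * ε ≤ ε := mul_le_of_le_one_left hε.le hα.2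
    rw [mul_add] at h3
    linarith
  · refine le_trans (le_of_eq ?_) (hle _ L.zeroStop x)
    unfold reward
    have : ∫ ω, α ^ (0 : ℕ∞).toNat * f (ω (0 : ℕ∞).toNat) ∂(ℙ x) = ∫ ω, f x ∂(ℙ x) := by
      refine integral_congr_ae ?_
      filter_upwards [L.start x] with ω h
      simp [h]
    rw [this]
    have := hprob x
    simp
  · exact ciSup_le fun τ => L.upper hα hf hg hfg τ.2 x
end

section
/- Let α ∈ (0,1] and f : S → ℝ nonnegative, and define the operator Q on functions y : S → ℝ by (Q y)(x) = max{f(x), α (P y)(x)}. Then the sequence of iterates (Qⁿ f)(x) is nondecreasing in n and bounded above by max_{s∈S} f(s) for every x; its pointwise limit Ṽ(x) := lim_{n→∞} (Qⁿ f)(x) exists, satisfies Ṽ(x) = max{f(x), α (P Ṽ)(x)} for all x, and is the smallest α-excessive majorant of f: Ṽ is α-excessive, Ṽ ≥ f, and every α-excessive g with g ≥ f pointwise satisfies g ≥ Ṽ pointwise. -/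
/-- for `α ∈ (0,1]`, nonnegative `f`, and the operator
`(Q y)(x) = max {f(x), α (P y)(x)}` with `P` a stochastic matrix on the finite
state space `S`, the iterates `(Qⁿ f)(x)` are nondecreasing in `n` and bounded
above by `max_s f(s)`; their pointwise limit `Ṽ` exists, satisfies
`Ṽ(x) = max {f(x), α (P Ṽ)(x)}`, and is the smallest `α`-excessive majorant of
`f`: `Ṽ` is `α`-excessive, `Ṽ ≥ f`, and every `α`-excessive `g ≥ f` satisfies
`g ≥ Ṽ` pointwise. -/
theorem stmt5 {S : Type*} [Fintype S] [Nonempty S]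
    (P : S → S → ℝ) (hP0 : ∀ x y, 0 ≤ P x y) (hP1 : ∀ x, ∑ y, P x y = 1)
    (α : ℝ) (hα : α ∈ Set.Ioc (0:ℝ) 1)
    (f : S → ℝ) (hf : ∀ x, 0 ≤ f x)
    (Q : (S → ℝ) → (S → ℝ))
    (hQ : ∀ y x, Q y x = max (f x) (α * ∑ z, P x z * y z)) :
    (∀ x, Monotone fun n : ℕ => (Q^[n] f) x) ∧
    (∀ (n : ℕ) (x : S), (Q^[n] f) x ≤ ⨆ s, f s) ∧
    ∃ Vt : S → ℝ,
      (∀ x, Filter.Tendsto (fun n : ℕ => (Q^[n] f) x) Filter.atTop (nhds (Vt x))) ∧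
      (∀ x, Vt x = max (f x) (α * ∑ z, P x z * Vt z)) ∧
      (∀ x, α * ∑ z, P x z * Vt z ≤ Vt x) ∧
      (∀ x, f x ≤ Vt x) ∧
      (∀ g : S → ℝ, (∀ x, α * ∑ z, P x z * g z ≤ g x) → (∀ x, f x ≤ g x) →
        ∀ x, Vt x ≤ g x) := by
  obtain ⟨hα0, hα1⟩ := hα
  have hmono : Monotone Q := by
    intro u v huv x
    rw [hQ, hQ]
    refine max_le_max le_rfl (mul_le_mul_of_nonneg_left ?_ hα0.le)
    exact Finset.sum_le_sum fun z _ => mul_le_mul_of_nonneg_left (huv z) (hP0 x z)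
  have hfQ : f ≤ Q f := fun x => by rw [hQ]; exact le_max_left _ _
  have hit : Monotone fun n : ℕ => Q^[n] f := hmono.monotone_iterate_of_le_map hfQ
  have hdom : ∀ g : S → ℝ, (∀ x, α * ∑ z, P x z * g z ≤ g x) → (∀ x, f x ≤ g x) →
      ∀ (n : ℕ) (x : S), (Q^[n] f) x ≤ g x := by
    intro g hg hfg n
    induction n with
    | zero => exact hfg
    | succ k ih =>
      intro x
      rw [Function.iterate_succ_apply']
      refine (hmono (show Q^[k] f ≤ g from ih) x).trans ?_
      rw [hQ]
      exact max_le (hfg x) (hg x)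
  have hsup : ∀ x, f x ≤ ⨆ s, f s := fun x => le_ciSup (Set.finite_range f).bddAbove x
  have hbd : ∀ (n : ℕ) (x : S), (Q^[n] f) x ≤ ⨆ s, f s := by
    refine hdom (fun _ => ⨆ s, f s) (fun x => ?_) hsup
    rw [← Finset.sum_mul, hP1, one_mul]
    exact mul_le_of_le_one_left ((hf x).trans (hsup x)) hα1
  have hlim : ∀ x, Filter.Tendsto (fun n : ℕ => (Q^[n] f) x) Filter.atTop
      (nhds (⨆ n : ℕ, (Q^[n] f) x)) := fun x =>
    tendsto_atTop_ciSup (fun a b h => hit h x) ⟨⨆ s, f s, by rintro _ ⟨n, rfl⟩; exact hbd n x⟩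
  refine ⟨fun x a b h => hit h x, hbd, fun x => ⨆ n : ℕ, (Q^[n] f) x, hlim, ?_⟩
  generalize hV : (fun x => ⨆ n : ℕ, (Q^[n] f) x) = V
  replace hlim : ∀ x, Filter.Tendsto (fun n : ℕ => (Q^[n] f) x) Filter.atTop (nhds (V x)) := by
    intro x
    rw [← hV]
    exact hlim x
  have hfix : ∀ x, V x = max (f x) (α * ∑ z, P x z * V z) := by
    intro x
    have h1 := (hlim x).comp (Filter.tendsto_add_atTop_nat 1)
    have h2 : Filter.Tendsto (fun n : ℕ => max (f x) (α * ∑ z, P x z * (Q^[n] f) z))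
        Filter.atTop (nhds (max (f x) (α * ∑ z, P x z * V z))) :=
      tendsto_const_nhds.max ((tendsto_finsetSum _ fun z _ => (hlim z).const_mul (P x z)).const_mul α)
    refine tendsto_nhds_unique h1 (h2.congr fun n => ?_)
    simp only [Function.comp, Function.iterate_succ_apply', hQ]
  refine ⟨hfix, fun x => ?_, fun x => ?_, fun g hg hfg x => ?_⟩
  · exact (le_max_right _ _).trans (hfix x).ge
  · exact (le_max_left _ _).trans (hfix x).ge
  · exact le_of_tendsto' (hlim x) fun n => hdom g hg hfg n x
end

section
/- Let α ∈ (0,1) and f : S → ℝ nonnegative, let V(x) = sup over stopping times τ of E_x[α^τ f(X_τ)], set Γ₊ := {x ∈ S : V(x) = f(x)}, and let τ* := inf{n ∈ ℕ : X_n ∈ Γ₊} be the first entrance time into Γ₊. Then for every x ∈ S: lim_{n→∞} ℙ_x(τ* > n) = 0 (in particular τ* is a stopping time), τ* is optimal, i.e. E_x[α^{τ*} f(X_{τ*})] = V(x), and with τ_n := min(τ*, n) one has E_x[α^{τ_n} V(X_{τ_n})] = V(x) for every n ∈ ℕ. -/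
open MeasureTheory

namespace OptStop

def Dep {S β : Type*} (n : ℕ) (G : (ℕ → S) → β) : Prop :=
  ∀ ω ω' : ℕ → S, (∀ i ≤ n, ω i = ω' i) → G ω = G ω'

def ext {S : Type*} (n : ℕ) (p : Fin (n + 1) → S) : ℕ → S :=
  fun i => p ⟨min i n, by omega⟩

def res {S : Type*} (n : ℕ) (ω : ℕ → S) : Fin (n + 1) → S := fun i => ω i

lemma ext_res {S : Type*} (n : ℕ) (ω : ℕ → S) (i : ℕ) (hi : i ≤ n) :
    ext n (res n ω) i = ω i := by
  simp [ext, res, hi]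

lemma measurable_res {S : Type*} [MeasurableSpace S] (n : ℕ) :
    Measurable (res n : (ℕ → S) → _) := by
  unfold res
  fun_prop

lemma Dep.eq {S β : Type*} {n : ℕ} {G : (ℕ → S) → β} (h : Dep n G) (ω : ℕ → S) :
    G ω = G (ext n (res n ω)) :=
  h _ _ fun i hi => (ext_res n ω i hi).symm

lemma Dep.mono {S β : Type*} {n m : ℕ} {G : (ℕ → S) → β} (h : Dep n G) (hnm : n ≤ m) :
    Dep m G := fun ω ω' hh => h ω ω' fun i hi => hh i (hi.trans hnm)

lemma Dep.measurable {S β : Type*} [Finite S] [MeasurableSpace S] [MeasurableSingletonClass S]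
    [MeasurableSpace β] {n : ℕ} {G : (ℕ → S) → β} (h : Dep n G) : Measurable G := by
  have : G = (fun p => G (ext n p)) ∘ res n := by
    funext ω; exact h.eq ω
  rw [this]
  exact (measurable_of_finite _).comp (measurable_res n)

lemma Dep.integrable {S : Type*} [Finite S] [MeasurableSpace S] [MeasurableSingletonClass S]
    {n : ℕ} {G : (ℕ → S) → ℝ} (h : Dep n G) (μ : Measure (ℕ → S)) [IsFiniteMeasure μ] :
    Integrable G μ := by
  have : G = (fun p => G (ext n p)) ∘ res n := by
    funext ω; exact h.eq ω
  rw [this]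
  have := (Integrable.of_finite (μ := μ.map (res n)) (f := fun p => G (ext n p)))
  exact this.comp_measurable (measurable_res n)

/-- one-step Markov property -/
lemma step {S : Type*} [Fintype S] [DecidableEq S] [MeasurableSpace S]
    [MeasurableSingletonClass S]
    (P : S → S → ℝ) (hP0 : ∀ x y, 0 ≤ P x y)
    (μ : Measure (ℕ → S)) [IsProbabilityMeasure μ] (x : S)
    (hM : ∀ (n : ℕ) (path : ℕ → S),
      μ {ω | ∀ i ≤ n, ω i = path i}
        = ENNReal.ofReal ((if path 0 = x then (1:ℝ) else 0) *
            ∏ i ∈ Finset.range n, P (path i) (path (i + 1))))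
    (n : ℕ) (G : (ℕ → S) → ℝ) (hG : Dep n G) (g : S → ℝ) :
    ∫ ω, G ω * g (ω (n + 1)) ∂μ = ∫ ω, G ω * (∑ y, P (ω n) y * g y) ∂μ := by
  have hMr : ∀ (n : ℕ) (path : ℕ → S), μ.real {ω | ∀ i ≤ n, ω i = path i}
      = (if path 0 = x then (1:ℝ) else 0) * ∏ i ∈ Finset.range n, P (path i) (path (i + 1)) := by
    intro n path
    rw [measureReal_def, hM, ENNReal.toReal_ofReal]
    exact mul_nonneg (by split_ifs <;> norm_num) (Finset.prod_nonneg fun _ _ => hP0 _ _)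
  have h1 : ∀ (p : Fin (n + 1) → S), res n ⁻¹' {p} = {ω | ∀ i ≤ n, ω i = ext n p i} := by
    intro p
    ext ω
    simp only [Set.mem_preimage, Set.mem_singleton_iff, Set.mem_ofPred_eq]
    constructor
    · rintro rfl i hi
      exact (ext_res n ω i hi).symm
    · intro h
      funext i
      have := h i (by omega)
      have hi : min (i : ℕ) n = i := by omega
      simp only [res, this, ext, hi]
  have h2 : ∀ (p : Fin (n + 1) → S) (y : S), (fun ω => (res n ω, ω (n+1))) ⁻¹' {(p, y)}
      = {ω | ∀ i ≤ n + 1, ω i = Function.update (ext n p) (n+1) y i} := by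
    intro p y
    have := h1 p
    ext ω
    have h3 : res n ω = p ↔ ∀ i ≤ n, ω i = ext n p i := by
      simpa using Set.ext_iff.1 this ω
    simp only [Set.mem_preimage, Set.mem_singleton_iff, Set.mem_ofPred_eq, Prod.mk.injEq, h3]
    constructor
    · rintro ⟨h, rfl⟩ i hi
      rcases Nat.lt_or_ge n i with h' | h'
      · obtain rfl : i = n + 1 := by omega
        simp
      · rw [Function.update_of_ne (by omega)]; exact h i h'
    · intro h
      refine ⟨fun i hi => ?_, by simpa using h (n+1) le_rfl⟩
      have := h i (by omega)
      rwa [Function.update_of_ne (by omega)] at this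
  have h4 : ∀ (p : Fin (n + 1) → S) (y : S),
      μ.real ((fun ω => (res n ω, ω (n+1))) ⁻¹' {(p, y)})
        = μ.real (res n ⁻¹' {p}) * P (ext n p n) y := by
    intro p y
    rw [h1, h2, hMr, hMr, Finset.prod_range_succ, ← mul_assoc]
    rw [Function.update_self, Function.update_of_ne (by omega), Function.update_of_ne (by omega)]
    congr 2
    refine Finset.prod_congr rfl fun i hi => ?_
    have := Finset.mem_range.1 hi
    rw [Function.update_of_ne (by omega), Function.update_of_ne (by omega)]
  have hm2 : Measurable (fun ω : ℕ → S => (res n ω, ω (n+1))) :=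
    (measurable_res n).prodMk (measurable_pi_apply _)
  have hL : ∫ ω, G ω * g (ω (n + 1)) ∂μ
      = ∑ q : (Fin (n+1) → S) × S, μ.real ((fun ω => (res n ω, ω (n+1))) ⁻¹' {q})
          * (G (ext n q.1) * g q.2) := by
    have e : ∀ ω, G ω * g (ω (n+1)) =
        (fun q : (Fin (n+1) → S) × S => G (ext n q.1) * g q.2) (res n ω, ω (n+1)) := by
      intro ω; simp only; rw [← hG.eq ω]
    rw [integral_congr_ae (ae_of_all _ e)]
    rw [← integral_map (f := fun q : (Fin (n+1) → S) × S => G (ext n q.1) * g q.2)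
      hm2.aemeasurable (measurable_of_finite _).aestronglyMeasurable]
    have := Measure.isProbabilityMeasure_map (μ := μ) hm2.aemeasurable
    rw [integral_fintype (Integrable.of_finite)]
    refine Finset.sum_congr rfl fun q _ => ?_
    rw [map_measureReal_apply hm2 (measurableSet_singleton _), smul_eq_mul]
  have hR : ∫ ω, G ω * (∑ y, P (ω n) y * g y) ∂μ
      = ∑ p : (Fin (n+1) → S), μ.real (res n ⁻¹' {p})
          * (G (ext n p) * ∑ y, P (ext n p n) y * g y) := by
    have e : ∀ ω, G ω * (∑ y, P (ω n) y * g y) =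
        (fun p : (Fin (n+1) → S) => G (ext n p) * ∑ y, P (ext n p n) y * g y) (res n ω) := by
      intro ω; simp only; rw [← hG.eq ω, ext_res n ω n le_rfl]
    rw [integral_congr_ae (ae_of_all _ e)]
    rw [← integral_map (f := fun p : (Fin (n+1) → S) => G (ext n p) * ∑ y, P (ext n p n) y * g y)
      (measurable_res n).aemeasurable (measurable_of_finite _).aestronglyMeasurable]
    have := Measure.isProbabilityMeasure_map (μ := μ) (measurable_res n).aemeasurable
    rw [integral_fintype (Integrable.of_finite)]
    refine Finset.sum_congr rfl fun q _ => ?_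
    rw [map_measureReal_apply (measurable_res n) (measurableSet_singleton _), smul_eq_mul]
  rw [hL, hR, Fintype.sum_prod_type]
  refine Finset.sum_congr rfl fun p _ => ?_
  simp only [h4, Finset.mul_sum]
  exact Finset.sum_congr rfl fun y _ => by ring

lemma start {S : Type*} [Fintype S] [DecidableEq S] [MeasurableSpace S]
    [MeasurableSingletonClass S]
    (P : S → S → ℝ)
    (μ : Measure (ℕ → S)) [IsProbabilityMeasure μ] (x : S)
    (hM : ∀ (n : ℕ) (path : ℕ → S),
      μ {ω | ∀ i ≤ n, ω i = path i}
        = ENNReal.ofReal ((if path 0 = x then (1:ℝ) else 0) *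
            ∏ i ∈ Finset.range n, P (path i) (path (i + 1)))) (g : S → ℝ) :
    ∫ ω, g (ω 0) ∂μ = g x := by
  have h := hM 0 (fun _ => x)
  simp at h
  have h2 : ∀ᵐ ω ∂μ, ω 0 = x := by
    have hm : MeasurableSet {ω : ℕ → S | ω 0 = x} :=
      measurableSet_eq_fun (measurable_pi_apply 0) measurable_const
    exact (prob_compl_eq_zero_iff hm).2 h
  rw [integral_congr_ae (g := fun _ => g x) (by filter_upwards [h2] with ω hω; rw [hω])]
  simp

lemma exists_fix {S : Type*} [Fintype S] [Nonempty S]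
    (P : S → S → ℝ) (hP0 : ∀ x y, 0 ≤ P x y) (hP1 : ∀ x, ∑ y, P x y = 1)
    (α : ℝ) (hα : α ∈ Set.Ioo (0:ℝ) 1) (f : S → ℝ) :
    ∃ W : S → ℝ, ∀ x, W x = max (f x) (α * ∑ y, P x y * W y) := by
  let T : (S → ℝ) → (S → ℝ) := fun W x => max (f x) (α * ∑ y, P x y * W y)
  have hT : ContractingWith α.toNNReal T := by
    refine ⟨?_, LipschitzWith.of_dist_le_mul fun u v => ?_⟩
    · simpa using hα.2
    · rw [Real.coe_toNNReal _ hα.1.le]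
      rw [dist_pi_le_iff (mul_nonneg hα.1.le dist_nonneg)]
      intro x
      rw [Real.dist_eq]
      refine (abs_max_sub_max_le_max _ _ _ _).trans ?_
      refine max_le (by simpa using mul_nonneg hα.1.le dist_nonneg) ?_
      rw [← mul_sub, ← Finset.sum_sub_distrib, abs_mul, abs_of_pos hα.1]
      refine mul_le_mul_of_nonneg_left ?_ hα.1.le
      refine (Finset.abs_sum_le_sum_abs _ _).trans ?_
      calc _ ≤ ∑ y, P x y * dist u v := Finset.sum_le_sum fun y _ => by
            rw [← mul_sub, abs_mul, abs_of_nonneg (hP0 x y)]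
            exact mul_le_mul_of_nonneg_left (dist_le_pi_dist u v y) (hP0 x y)
        _ = dist u v := by rw [← Finset.sum_mul, hP1, one_mul]
  refine ⟨hT.fixedPoint T, fun x => ?_⟩
  exact (congrFun hT.fixedPoint_isFixedPt x).symm

/-- a subharmonic killed function vanishes -/
lemma killed_zero {S : Type*} [Fintype S]
    (P : S → S → ℝ) (hP0 : ∀ x y, 0 ≤ P x y) (hP1 : ∀ x, ∑ y, P x y = 1)
    (α : ℝ) (hα : α ∈ Set.Ioo (0:ℝ) 1) (f : S → ℝ) (hf : ∀ x, 0 ≤ f x)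
    (W : S → ℝ) (hW : ∀ x, W x = max (f x) (α * ∑ y, P x y * W y))
    (q : S → ℝ) (hq0 : ∀ x, 0 ≤ q x)
    (hq1 : ∀ x, W x = f x → q x = 0)
    (hq2 : ∀ x, W x ≠ f x → q x = ∑ y, P x y * q y) (x : S) : q x = 0 := by
  by_contra hx
  have : Nonempty S := ⟨x⟩
  have hWf : ∀ x, f x ≤ W x := fun x => by rw [hW]; exact le_max_left _ _
  obtain ⟨a, ha⟩ := Finite.exists_max q
  have hapos : 0 < q a := lt_of_lt_of_le (lt_of_le_of_ne (hq0 x) (Ne.symm hx)) (ha x)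
  classical
  let A : Finset S := Finset.univ.filter fun y => q y = q a
  obtain ⟨b, hbA, hb⟩ := A.exists_max_image W ⟨a, by simp [A]⟩
  have hqb : q b = q a := by simpa [A] using hbA
  have hbG : W b ≠ f b := fun h => by rw [hq1 b h] at hqb; linarith
  have hcl : ∀ y, P b y ≠ 0 → q y = q a := by
    intro y hy
    have h1 : ∑ y, P b y * (q a - q y) = 0 := by
      simp_rw [mul_sub]
      rw [Finset.sum_sub_distrib, ← Finset.sum_mul, hP1, ← hq2 b hbG, hqb]; ring
    have h2 := (Finset.sum_eq_zero_iff_of_nonneg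
      (fun y _ => mul_nonneg (hP0 b y) (sub_nonneg.2 (ha y)))).1 h1 y (Finset.mem_univ _)
    rcases mul_eq_zero.1 h2 with h | h
    · exact absurd h hy
    · linarith
  have hWb : W b = α * ∑ y, P b y * W y := by
    rcases max_choice (f b) (α * ∑ y, P b y * W y) with h | h
    · exact absurd ((hW b).trans h) hbG
    · exact (hW b).trans h
  have hle : ∑ y, P b y * W y ≤ W b := by
    calc _ ≤ ∑ y, P b y * W b := Finset.sum_le_sum fun y _ => by
          by_cases hy : P b y = 0
          · simp [hy]
          · exact mul_le_mul_of_nonneg_left (hb y (by simp [A, hcl y hy])) (hP0 b y)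
      _ = W b := by rw [← Finset.sum_mul, hP1, one_mul]
  have hWb0 : 0 ≤ W b := (hf b).trans (hWf b)
  have : W b ≤ α * W b := by
    conv_lhs => rw [hWb]
    exact mul_le_mul_of_nonneg_left hle hα.1.le
  have : W b ≤ 0 := by nlinarith [hα.2]
  exact hbG (le_antisymm (this.trans (hf b)) (hWf b))

open Classical in
noncomputable def qf {S : Type*} [Fintype S] (P : S → S → ℝ) (Γ : S → Prop) : ℕ → S → ℝ
  | 0, x => if Γ x then 0 else 1
  | n + 1, x => if Γ x then 0 else ∑ y, P x y * qf P Γ n y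

open Classical in
lemma surv {S : Type*} [Fintype S] [DecidableEq S] [MeasurableSpace S]
    [MeasurableSingletonClass S]
    (P : S → S → ℝ) (hP0 : ∀ x y, 0 ≤ P x y)
    (μ : Measure (ℕ → S)) [IsProbabilityMeasure μ] (x : S)
    (hM : ∀ (n : ℕ) (path : ℕ → S),
      μ {ω | ∀ i ≤ n, ω i = path i}
        = ENNReal.ofReal ((if path 0 = x then (1:ℝ) else 0) *
            ∏ i ∈ Finset.range n, P (path i) (path (i + 1))))
    (Γ : S → Prop) (k m : ℕ) :
    ∫ ω, (if ∀ i < k, ¬ Γ (ω i) then (1:ℝ) else 0) * qf P Γ m (ω k) ∂μ = qf P Γ (k + m) x := by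
  induction k generalizing m with
  | zero => simpa using start P μ x hM (qf P Γ m)
  | succ k ih =>
    rw [step P hP0 μ x hM k (fun ω => if ∀ i < k + 1, ¬ Γ (ω i) then (1:ℝ) else 0)]
    · rw [show k + 1 + m = k + (m + 1) by ring, ← ih]
      refine integral_congr_ae (ae_of_all _ fun ω => ?_)
      simp only [qf, Nat.forall_lt_succ_right]
      by_cases h1 : ∀ i < k, ¬ Γ (ω i) <;> by_cases h2 : Γ (ω k) <;> simp [h1, h2]
    · intro ω ω' h
      have : (∀ i < k + 1, ¬ Γ (ω i)) ↔ (∀ i < k + 1, ¬ Γ (ω' i)) :=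
        forall₂_congr fun i hi => by rw [h i (by omega)]
      simp only [this]

lemma surv_measure {S : Type*} [Fintype S] [DecidableEq S] [MeasurableSpace S]
    [MeasurableSingletonClass S]
    (P : S → S → ℝ) (hP0 : ∀ x y, 0 ≤ P x y)
    (μ : Measure (ℕ → S)) [IsProbabilityMeasure μ] (x : S)
    (hM : ∀ (n : ℕ) (path : ℕ → S),
      μ {ω | ∀ i ≤ n, ω i = path i}
        = ENNReal.ofReal ((if path 0 = x then (1:ℝ) else 0) *
            ∏ i ∈ Finset.range n, P (path i) (path (i + 1))))
    (Γ : S → Prop) (n : ℕ) :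
    μ {ω | ∀ i ≤ n, ¬ Γ (ω i)} = ENNReal.ofReal (qf P Γ n x) := by
  classical
  have hmeas : MeasurableSet {ω : ℕ → S | ∀ i ≤ n, ¬ Γ (ω i)} := by
    have hd : Dep n (fun ω : ℕ → S => ∀ i ≤ n, ¬ Γ (ω i)) := by
      intro ω ω' h
      exact propext (forall₂_congr fun i hi => by rw [h i hi])
    exact measurableSet_setOfPred.2 hd.measurable
  have h := surv P hP0 μ x hM Γ n 0
  rw [add_zero] at h
  rw [← h, ← ofReal_measureReal (measure_ne_top _ _), ← integral_indicator_one hmeas]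
  congr 1
  refine integral_congr_ae (ae_of_all _ fun ω => ?_)
  have : (∀ i ≤ n, ¬ Γ (ω i)) ↔ (∀ i < n, ¬ Γ (ω i)) ∧ ¬ Γ (ω n) := by
    simp only [← Nat.lt_succ_iff, Nat.forall_lt_succ_right]
  simp only [Set.indicator_apply, Set.mem_ofPred_eq, this, qf, Pi.one_apply]
  by_cases h1 : ∀ i < n, ¬ Γ (ω i) <;> by_cases h2 : Γ (ω n) <;> simp [h1, h2]

lemma qf_tendsto {S : Type*} [Fintype S]
    (P : S → S → ℝ) (hP0 : ∀ x y, 0 ≤ P x y) (hP1 : ∀ x, ∑ y, P x y = 1)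
    (α : ℝ) (hα : α ∈ Set.Ioo (0:ℝ) 1) (f : S → ℝ) (hf : ∀ x, 0 ≤ f x)
    (W : S → ℝ) (hW : ∀ x, W x = max (f x) (α * ∑ y, P x y * W y)) (x : S) :
    Filter.Tendsto (fun n => qf P (fun x => W x = f x) n x) Filter.atTop (nhds 0) := by
  set Γ : S → Prop := fun x => W x = f x with hΓ
  have h0 : ∀ n x, 0 ≤ qf P Γ n x := by
    intro n
    induction n with
    | zero => intro x; simp only [qf]; split_ifs <;> norm_num
    | succ n ih =>
      intro x; simp only [qf]; split_ifs
      · exact le_rfl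
      · exact Finset.sum_nonneg fun y _ => mul_nonneg (hP0 _ _) (ih y)
  have hanti : ∀ n x, qf P Γ (n + 1) x ≤ qf P Γ n x := by
    intro n
    induction n with
    | zero =>
      intro x; simp only [qf]; split_ifs
      · exact le_rfl
      · refine le_trans ?_ (hP1 x).le
        refine Finset.sum_le_sum fun y _ => ?_
        have := hP0 x y
        split_ifs <;> simp [this]
    | succ n ih =>
      intro x; rw [qf]; conv_rhs => rw [qf]
      split_ifs
      · exact le_rfl
      · exact Finset.sum_le_sum fun y _ => mul_le_mul_of_nonneg_left (ih y) (hP0 _ _)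
  have hlim : ∀ x, Filter.Tendsto (fun n => qf P Γ n x) Filter.atTop
      (nhds (⨅ n, qf P Γ n x)) := fun x =>
    tendsto_atTop_ciInf (antitone_nat_of_succ_le fun n => hanti n x)
      ⟨0, by rintro _ ⟨n, rfl⟩; exact h0 n x⟩
  have hz := killed_zero P hP0 hP1 α hα f hf W hW (fun x => ⨅ n, qf P Γ n x)
    (fun x => ge_of_tendsto' (hlim x) fun n => h0 n x) ?_ ?_ x
  · have := hlim x
    rwa [hz] at this
  · intro y hy
    refine tendsto_nhds_unique (hlim y) ?_
    have : ∀ n, qf P Γ n y = 0 := by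
      intro n; cases n <;> simp [qf, hΓ, hy]
    simp [this]
  · intro y hy
    refine tendsto_nhds_unique ((hlim y).comp (Filter.tendsto_add_atTop_nat 1)) ?_
    have : ((fun n => qf P Γ n y) ∘ fun n => n + 1)
        = fun n => ∑ z, P y z * qf P Γ n z := by
      funext n; simp [qf, hΓ, hy]
    rw [this]
    exact tendsto_finsetSum _ fun z _ => (hlim z).const_mul _

def Stop {S : Type*} (τ : (ℕ → S) → ℕ∞) : Prop :=
  ∀ (n : ℕ) (ω ω' : ℕ → S), (∀ i ≤ n, ω i = ω' i) → τ ω = (n : ℕ∞) → τ ω' = (n : ℕ∞)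

lemma Stop.min_dep {S : Type*} {τ : (ℕ → S) → ℕ∞} (h : Stop τ) (n : ℕ) :
    Dep n (fun ω => min (τ ω) (n : ℕ∞)) := by
  have key : ∀ ω ω' : ℕ → S, (∀ i ≤ n, ω i = ω' i) → τ ω ≤ n → τ ω' = τ ω := by
    intro ω ω' hh hle
    lift τ ω to ℕ using (ne_top_of_le_ne_top (by simp) hle) with k hk
    have : k ≤ n := by exact_mod_cast hle
    exact h k ω ω' (fun i hi => hh i (hi.trans this)) hk.symm
  intro ω ω' hh
  simp only
  rcases le_total (τ ω) n with h1 | h1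
  · rw [key ω ω' hh h1]
  · rcases le_total (τ ω') n with h2 | h2
    · rw [key ω' ω (fun i hi => (hh i hi).symm) h2]
    · rw [min_eq_right h1, min_eq_right h2]

lemma Stop.lt_dep {S : Type*} {τ : (ℕ → S) → ℕ∞} (h : Stop τ) (n : ℕ) :
    Dep n (fun ω => (n : ℕ∞) < τ ω) := by
  have key : ∀ ω ω' : ℕ → S, (∀ i ≤ n, ω i = ω' i) → τ ω ≤ n → τ ω' ≤ n := by
    intro ω ω' hh hle
    have := h.min_dep n ω ω' hh
    simp only [min_eq_left hle] at this
    by_contra hc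
    push Not at hc
    rw [min_eq_right hc.le] at this
    lift τ ω to ℕ using (ne_top_of_le_ne_top (by simp) hle) with k hk
    have e : k = n := by exact_mod_cast this
    rw [h k ω ω' (fun i hi => hh i (by omega)) hk.symm, e] at hc
    exact lt_irrefl _ hc
  intro ω ω' hh
  simp only [eq_iff_iff, ← not_le]
  exact not_congr ⟨key ω ω' hh, key ω' ω fun i hi => (hh i hi).symm⟩

noncomputable def stopped {S : Type*} (α : ℝ) (g : S → ℝ) (τ : (ℕ → S) → ℕ∞) (n : ℕ)
    (ω : ℕ → S) : ℝ :=
  α ^ (min (τ ω) (n : ℕ∞)).toNat * g (ω ((min (τ ω) (n : ℕ∞)).toNat))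

lemma min_toNat_le (t : ℕ∞) (n : ℕ) : (min t (n : ℕ∞)).toNat ≤ n :=
  ENat.toNat_le_of_le_natCast (min_le_right _ _)

lemma stopped_dep {S : Type*} (α : ℝ) (g : S → ℝ) {τ : (ℕ → S) → ℕ∞} (h : Stop τ) (n : ℕ) :
    Dep n (stopped α g τ n) := by
  intro ω ω' hh
  have := h.min_dep n ω ω' hh
  simp only at this
  unfold stopped
  rw [this, hh _ (min_toNat_le _ _)]

open Classical in
lemma stopped_succ {S : Type*} (α : ℝ) (g : S → ℝ) (τ : (ℕ → S) → ℕ∞) (n : ℕ) (ω : ℕ → S) :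
    stopped α g τ (n + 1) ω = stopped α g τ n ω +
      ((α ^ (n + 1) * (if (n : ℕ∞) < τ ω then 1 else 0)) * g (ω (n + 1))
        - (α ^ n * (if (n : ℕ∞) < τ ω then 1 else 0)) * g (ω n)) := by
  unfold stopped
  by_cases h : (n : ℕ∞) < τ ω
  · have h1 : ((n + 1 : ℕ) : ℕ∞) ≤ τ ω := by
      rw [Nat.cast_add, Nat.cast_one]; exact Order.add_one_le_of_lt h
    rw [min_eq_right h1, min_eq_right h.le]
    simp only [ENat.toNat_natCast, h, if_true]
    ring
  · have h2 : τ ω ≤ n := not_lt.1 h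
    have h3 : τ ω ≤ (n + 1 : ℕ) := h2.trans (by exact_mod_cast Nat.le_succ n)
    rw [min_eq_left h2, min_eq_left h3]
    simp [h]

open Classical in
lemma integral_stopped_succ {S : Type*} [Fintype S] [DecidableEq S] [MeasurableSpace S]
    [MeasurableSingletonClass S]
    (P : S → S → ℝ) (hP0 : ∀ x y, 0 ≤ P x y)
    (μ : Measure (ℕ → S)) [IsProbabilityMeasure μ] (x : S)
    (hM : ∀ (n : ℕ) (path : ℕ → S),
      μ {ω | ∀ i ≤ n, ω i = path i}
        = ENNReal.ofReal ((if path 0 = x then (1:ℝ) else 0) *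
            ∏ i ∈ Finset.range n, P (path i) (path (i + 1))))
    (α : ℝ) (g : S → ℝ) {τ : (ℕ → S) → ℕ∞} (h : Stop τ) (n : ℕ) :
    ∫ ω, stopped α g τ (n + 1) ω ∂μ = ∫ ω, stopped α g τ n ω ∂μ +
      ∫ ω, (α ^ n * (if (n : ℕ∞) < τ ω then 1 else 0)) *
        (α * ∑ y, P (ω n) y * g y - g (ω n)) ∂μ := by
  have hd : ∀ c : ℝ, Dep n (fun ω => c * (if (n : ℕ∞) < τ ω then (1:ℝ) else 0)) := by
    intro c ω ω' hh
    have := h.lt_dep n ω ω' hh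
    simp only at this
    simp only [this]
  have i0 := (stopped_dep α g h n).integrable μ
  have i1 : Integrable (fun ω => (α ^ (n+1) * (if (n : ℕ∞) < τ ω then (1:ℝ) else 0))
      * g (ω (n + 1))) μ := by
    refine Dep.integrable (n := n + 1) ?_ μ
    intro ω ω' hh
    have := (hd (α^(n+1))).mono (Nat.le_succ n) ω ω' hh
    simp only at this
    simp only [this, hh (n+1) le_rfl]
  have i2 : ∀ (c : ℝ) (k : S → ℝ),
      Integrable (fun ω => (c * (if (n : ℕ∞) < τ ω then (1:ℝ) else 0)) * k (ω n)) μ := by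
    intro c k
    refine Dep.integrable (n := n) ?_ μ
    intro ω ω' hh
    have := hd c ω ω' hh
    simp only at this
    simp only [this, hh n le_rfl]
  simp only [stopped_succ]
  have i3 : Integrable (fun ω => (α ^ (n+1) * (if (n : ℕ∞) < τ ω then (1:ℝ) else 0))
      * g (ω (n + 1)) - (α ^ n * (if (n : ℕ∞) < τ ω then (1:ℝ) else 0)) * g (ω n)) μ :=
    i1.sub (i2 _ _)
  rw [integral_add i0 i3, integral_sub i1 (i2 _ _),
    step P hP0 μ x hM n _ (hd _) g,
    ← integral_sub (i2 _ (fun z => ∑ y, P z y * g y)) (i2 _ _)]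
  congr 1
  refine integral_congr_ae (ae_of_all _ fun ω => ?_)
  simp only
  ring

lemma integral_stopped_zero {S : Type*} [Fintype S] [DecidableEq S] [MeasurableSpace S]
    [MeasurableSingletonClass S]
    (P : S → S → ℝ)
    (μ : Measure (ℕ → S)) [IsProbabilityMeasure μ] (x : S)
    (hM : ∀ (n : ℕ) (path : ℕ → S),
      μ {ω | ∀ i ≤ n, ω i = path i}
        = ENNReal.ofReal ((if path 0 = x then (1:ℝ) else 0) *
            ∏ i ∈ Finset.range n, P (path i) (path (i + 1))))
    (α : ℝ) (g : S → ℝ) (τ : (ℕ → S) → ℕ∞) :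
    ∫ ω, stopped α g τ 0 ω ∂μ = g x := by
  simpa [stopped] using start P μ x hM g

lemma stopped_tendsto {S : Type*} [Fintype S] [MeasurableSpace S]
    [MeasurableSingletonClass S] (μ : Measure (ℕ → S)) [IsProbabilityMeasure μ]
    (α : ℝ) (hα : α ∈ Set.Ioo (0:ℝ) 1) (g : S → ℝ) {τ : (ℕ → S) → ℕ∞} (h : Stop τ)
    (hfin : ∀ᵐ ω ∂μ, τ ω ≠ ⊤) :
    Filter.Tendsto (fun n => ∫ ω, stopped α g τ n ω ∂μ) Filter.atTop
      (nhds (∫ ω, α ^ (τ ω).toNat * g (ω (τ ω).toNat) ∂μ)) := by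
  refine tendsto_integral_of_dominated_convergence (fun _ => ∑ y, |g y|)
    (fun n => (stopped_dep α g h n).measurable.aestronglyMeasurable)
    (integrable_const _) (fun n => ae_of_all _ fun ω => ?_) ?_
  · unfold stopped
    rw [norm_mul, Real.norm_eq_abs, Real.norm_eq_abs, abs_of_nonneg (pow_nonneg hα.1.le _)]
    refine (mul_le_of_le_one_left (abs_nonneg _) (pow_le_one₀ hα.1.le hα.2.le)).trans ?_
    exact Finset.single_le_sum (f := fun y => |g y|) (fun y _ => abs_nonneg _)
      (Finset.mem_univ _)
  · filter_upwards [hfin] with ω hω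
    refine tendsto_const_nhds.congr' ?_
    filter_upwards [Filter.eventually_ge_atTop (τ ω).toNat] with n hn
    have : τ ω ≤ n := by
      rw [← ENat.natCast_toNat hω]; exact_mod_cast hn
    rw [stopped, min_eq_left this]

lemma entr_le {S : Type*} (Γ : S → Prop) (ω : ℕ → S) (n : ℕ) :
    sInf {k : ℕ∞ | ∃ m : ℕ, (m : ℕ∞) = k ∧ Γ (ω m)} ≤ n ↔ ∃ i ≤ n, Γ (ω i) := by
  constructor
  · intro h
    rcases Set.eq_empty_or_nonempty {k : ℕ∞ | ∃ m : ℕ, (m : ℕ∞) = k ∧ Γ (ω m)} with he | he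
    · rw [he] at h; simp at h
    · obtain ⟨m, hm, hG⟩ := csInf_mem he
      rw [← hm] at h
      exact ⟨m, by exact_mod_cast h, hG⟩
  · rintro ⟨i, hi, hG⟩
    have h1 : (i : ℕ∞) ∈ {k : ℕ∞ | ∃ m : ℕ, (m : ℕ∞) = k ∧ Γ (ω m)} := ⟨i, rfl, hG⟩
    have h2 : (i : ℕ∞) ≤ n := by exact_mod_cast hi
    exact (sInf_le h1).trans h2

lemma eq_iff (t : ℕ∞) (n : ℕ) : t = n ↔ t ≤ n ∧ ∀ m < n, ¬ t ≤ (m : ℕ) := by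
  constructor
  · rintro rfl
    exact ⟨le_rfl, fun m hm h => by
      have : n ≤ m := by exact_mod_cast h
      omega⟩
  · rintro ⟨h1, h2⟩
    lift t to ℕ using (ne_top_of_le_ne_top (by simp) h1) with k
    have : k ≤ n := by exact_mod_cast h1
    by_contra hne
    have hne' : k ≠ n := fun h => hne (by rw [h])
    exact h2 k (by omega) le_rfl

lemma entr_stop {S : Type*} (Γ : S → Prop) {τ : (ℕ → S) → ℕ∞}
    (hτ : ∀ ω, τ ω = sInf {k : ℕ∞ | ∃ m : ℕ, (m : ℕ∞) = k ∧ Γ (ω m)}) : Stop τ := by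
  intro n ω ω' hh h
  rw [eq_iff, hτ, entr_le] at h ⊢
  simp only [entr_le] at h ⊢
  obtain ⟨⟨i, hi, hG⟩, h2⟩ := h
  refine ⟨⟨i, hi, by rwa [← hh i hi]⟩, ?_⟩
  rintro m hm ⟨j, hj, hG'⟩
  exact h2 m hm ⟨j, hj, by rwa [hh j (by omega)]⟩

lemma entr_at {S : Type*} (Γ : S → Prop) {τ : (ℕ → S) → ℕ∞}
    (hτ : ∀ ω, τ ω = sInf {k : ℕ∞ | ∃ m : ℕ, (m : ℕ∞) = k ∧ Γ (ω m)})
    (ω : ℕ → S) (n : ℕ) (h : τ ω = n) : Γ (ω n) := by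
  rw [eq_iff, hτ, entr_le] at h
  simp only [entr_le] at h
  obtain ⟨⟨i, hi, hG⟩, h2⟩ := h
  rcases hi.lt_or_eq with h | rfl
  · exact absurd ⟨i, le_rfl, hG⟩ (h2 i h)
  · exact hG

lemma entr_lt {S : Type*} (Γ : S → Prop) {τ : (ℕ → S) → ℕ∞}
    (hτ : ∀ ω, τ ω = sInf {k : ℕ∞ | ∃ m : ℕ, (m : ℕ∞) = k ∧ Γ (ω m)})
    (ω : ℕ → S) (n : ℕ) : (n : ℕ∞) < τ ω ↔ ∀ i ≤ n, ¬ Γ (ω i) := by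
  rw [← not_le, hτ, entr_le]
  push Not
  rfl

lemma main {S : Type*} [Fintype S] [DecidableEq S] [MeasurableSpace S]
    [MeasurableSingletonClass S]
    (P : S → S → ℝ) (hP0 : ∀ x y, 0 ≤ P x y) (hP1 : ∀ x, ∑ y, P x y = 1)
    (ℙ : S → Measure (ℕ → S)) (hprob : ∀ x, IsProbabilityMeasure (ℙ x))
    (hMarkov : ∀ (x : S) (n : ℕ) (path : ℕ → S),
      ℙ x {ω | ∀ i ≤ n, ω i = path i}
        = ENNReal.ofReal ((if path 0 = x then (1:ℝ) else 0) *
            ∏ i ∈ Finset.range n, P (path i) (path (i + 1))))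
    (α : ℝ) (hα : α ∈ Set.Ioo (0:ℝ) 1)
    (f : S → ℝ) (hf : ∀ x, 0 ≤ f x)
    (W : S → ℝ) (hW : ∀ x, W x = max (f x) (α * ∑ y, P x y * W y))
    (τ : (ℕ → S) → ℕ∞)
    (hτ : ∀ ω, τ ω = sInf {n : ℕ∞ | ∃ m : ℕ, (m : ℕ∞) = n ∧ W (ω m) = f (ω m)}) :
    (∀ x, Filter.Tendsto (fun n : ℕ => ℙ x {ω | (n : ℕ∞) < τ ω}) Filter.atTop (nhds 0)) ∧
    IsStopTime ℙ τ ∧ (∀ x, reward ℙ α f τ x = W x) ∧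
    (∀ x n, ∫ ω, stopped α W τ n ω ∂(ℙ x) = W x) ∧
    price ℙ α f = W := by
  have hτ' := hτ
  have hst : Stop τ := entr_stop (fun x => W x = f x) hτ
  have hlt := entr_lt (fun x => W x = f x) hτ
  have hat := entr_at (fun x => W x = f x) hτ
  have h1 : ∀ x, Filter.Tendsto (fun n : ℕ => ℙ x {ω | (n : ℕ∞) < τ ω})
      Filter.atTop (nhds 0) := by
    intro x
    have := qf_tendsto P hP0 hP1 α hα f hf W hW x
    have h2 := ENNReal.tendsto_ofReal this
    rw [ENNReal.ofReal_zero] at h2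
    refine h2.congr fun n => ?_
    have := hprob x
    rw [← surv_measure P hP0 (ℙ x) x (hMarkov x)]
    simp only [hlt]
  have hfin : ∀ x, ∀ᵐ ω ∂(ℙ x), τ ω ≠ ⊤ := by
    intro x
    rw [ae_iff]
    refine le_antisymm (ge_of_tendsto' (h1 x) fun n => measure_mono ?_) zero_le
    intro ω hω
    have : τ ω = ⊤ := by simpa using hω
    change (n : ℕ∞) < τ ω
    rw [this]; exact ENat.natCast_lt_top n
  have hIs : IsStopTime ℙ τ := by
    refine ⟨hst, fun x => ?_⟩
    have := hprob x
    rw [measure_congr (t := Set.univ), measure_univ]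
    exact Filter.eventuallyEq_univ.2 (hfin x)
  have h3 : ∀ x n, ∫ ω, stopped α W τ n ω ∂(ℙ x) = W x := by
    intro x n
    have := hprob x
    induction n with
    | zero => exact integral_stopped_zero P (ℙ x) x (hMarkov x) α W τ
    | succ n ih =>
      rw [integral_stopped_succ P hP0 (ℙ x) x (hMarkov x) α W hst n, ih, add_eq_left]
      refine integral_eq_zero_of_ae (ae_of_all _ fun ω => ?_)
      by_cases h : (n : ℕ∞) < τ ω
      · have hn : W (ω n) ≠ f (ω n) := (hlt ω n).1 h n le_rfl
        have : W (ω n) = α * ∑ y, P (ω n) y * W y := by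
          rcases max_choice (f (ω n)) (α * ∑ y, P (ω n) y * W y) with h | h
          · exact absurd ((hW _).trans h) hn
          · exact (hW _).trans h
        simp [← this]
      · simp [h]
  have h4 : ∀ x, reward ℙ α f τ x = W x := by
    intro x
    have := hprob x
    have ht := stopped_tendsto (ℙ x) α hα W hst (hfin x)
    simp only [h3] at ht
    rw [tendsto_nhds_unique tendsto_const_nhds ht]
    refine integral_congr_ae ?_
    filter_upwards [hfin x] with ω hω
    have := hat ω (τ ω).toNat (ENat.natCast_toNat hω).symm
    simp only [this]
  have h5 : ∀ (σ : (ℕ → S) → ℕ∞), IsStopTime ℙ σ → ∀ x, reward ℙ α f σ x ≤ W x := by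
    intro σ hσ x
    have := hprob x
    have hs : Stop σ := hσ.1
    have hsf : ∀ᵐ ω ∂(ℙ x), σ ω ≠ ⊤ := by
      have hm : MeasurableSet {ω | σ ω ≠ ⊤} := by
        have : {ω | σ ω ≠ ⊤} = ⋃ n : ℕ, {ω | ¬ ((n : ℕ∞) < σ ω)} := by
          ext ω
          simp only [Set.mem_ofPred_eq, Set.mem_iUnion, not_lt]
          constructor
          · intro h; exact ⟨(σ ω).toNat, (ENat.natCast_toNat h).ge⟩
          · rintro ⟨n, hn⟩; exact ne_top_of_le_ne_top (by simp) hn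
        rw [this]
        refine MeasurableSet.iUnion fun n => ?_
        exact (measurableSet_setOfPred.2 (hs.lt_dep n).measurable).compl
      exact (prob_compl_eq_zero_iff hm).2 (hσ.2 x)
    have hb : ∀ n, ∫ ω, stopped α W σ n ω ∂(ℙ x) ≤ W x := by
      intro n
      induction n with
      | zero => exact (integral_stopped_zero P (ℙ x) x (hMarkov x) α W σ).le
      | succ n ih =>
        rw [integral_stopped_succ P hP0 (ℙ x) x (hMarkov x) α W hs n]
        refine (add_le_of_nonpos_right ?_).trans ih
        refine integral_nonpos fun ω => ?_
        refine mul_nonpos_of_nonneg_of_nonpos ?_ ?_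
        · exact mul_nonneg (pow_nonneg hα.1.le _) (by split_ifs <;> norm_num)
        · have := hW (ω n)
          have := le_max_right (f (ω n)) (α * ∑ y, P (ω n) y * W y)
          linarith
    refine le_of_tendsto' (stopped_tendsto (ℙ x) α hα f hs hsf) fun n => ?_
    refine (integral_mono ((stopped_dep α f hs n).integrable _)
      ((stopped_dep α W hs n).integrable _) fun ω => ?_).trans (hb n)
    refine mul_le_mul_of_nonneg_left ?_ (pow_nonneg hα.1.le _)
    rw [hW]; exact le_max_left _ _
  refine ⟨h1, hIs, h4, h3, ?_⟩
  funext x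
  refine le_antisymm ?_ ?_
  · have : Nonempty {τ : (ℕ → S) → ℕ∞ // IsStopTime ℙ τ} := ⟨⟨τ, hIs⟩⟩
    exact ciSup_le fun σ => h5 σ.1 σ.2 x
  · rw [← h4 x]
    exact le_ciSup (f := fun τ : {τ : (ℕ → S) → ℕ∞ // IsStopTime ℙ τ} => reward ℙ α f τ.1 x)
      ⟨W x, by rintro _ ⟨σ, rfl⟩; exact h5 σ.1 σ.2 x⟩ ⟨τ, hIs⟩

end OptStop

/-- for `α ∈ (0,1)`, nonnegative `f`, price `V = price ℙ α f`,
`Γ₊ = {x | V x = f x}` and `τ* = inf {n | X_n ∈ Γ₊}` the first entrance time into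
`Γ₊`, one has for every `x`: `ℙ_x(τ* > n) → 0` as `n → ∞` (in particular `τ*` is
a stopping time), `τ*` is optimal, i.e. `E_x[α^{τ*} f(X_{τ*})] = V(x)`, and with
`τ_n = min(τ*, n)`, `E_x[α^{τ_n} V(X_{τ_n})] = V(x)` for every `n`. -/
theorem stmt6 {S : Type*} [Fintype S] [DecidableEq S] [MeasurableSpace S]
    [MeasurableSingletonClass S]
    (P : S → S → ℝ) (hP0 : ∀ x y, 0 ≤ P x y) (hP1 : ∀ x, ∑ y, P x y = 1)
    (ℙ : S → Measure (ℕ → S)) (hprob : ∀ x, IsProbabilityMeasure (ℙ x))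
    (hMarkov : ∀ (x : S) (n : ℕ) (path : ℕ → S),
      ℙ x {ω | ∀ i ≤ n, ω i = path i}
        = ENNReal.ofReal ((if path 0 = x then (1:ℝ) else 0) *
            ∏ i ∈ Finset.range n, P (path i) (path (i + 1))))
    (α : ℝ) (hα : α ∈ Set.Ioo (0:ℝ) 1)
    (f : S → ℝ) (hf : ∀ x, 0 ≤ f x)
    (τstar : (ℕ → S) → ℕ∞)
    (hτstar : ∀ ω, τstar ω =
      sInf {n : ℕ∞ | ∃ m : ℕ, (m : ℕ∞) = n ∧ price ℙ α f (ω m) = f (ω m)}) :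
    ∀ x : S,
      Filter.Tendsto (fun n : ℕ => ℙ x {ω | (n : ℕ∞) < τstar ω})
        Filter.atTop (nhds 0) ∧
      IsStopTime ℙ τstar ∧
      reward ℙ α f τstar x = price ℙ α f x ∧
      (∀ n : ℕ,
        ∫ ω, α ^ (min (τstar ω) (n : ℕ∞)).toNat *
          price ℙ α f (ω ((min (τstar ω) (n : ℕ∞)).toNat)) ∂(ℙ x)
        = price ℙ α f x) := by
  intro x
  have : Nonempty S := ⟨x⟩
  obtain ⟨W, hW⟩ := OptStop.exists_fix P hP0 hP1 α hα f
  have hV : price ℙ α f = W :=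
    (OptStop.main P hP0 hP1 ℙ hprob hMarkov α hα f hf W hW _ (fun _ => rfl)).2.2.2.2
  rw [hV] at hτstar ⊢
  obtain ⟨h1, h2, h3, h4, -⟩ :=
    OptStop.main P hP0 hP1 ℙ hprob hMarkov α hα f hf W hW τstar hτstar
  exact ⟨h1 x, h2, h3 x, h4 x⟩
end

section
/- Let g : S → ℝ and define H₊ := {x ∈ S : (P g)(x) > g(x)} and H₋ := {x ∈ S : (P g)(x) ≤ g(x)}. Suppose the transition matrix satisfies P x y = 0 for every x ∈ H₋ and y ∈ H₊ (i.e. the set H₋ cannot be left for H₊), and suppose the first entrance time τ̂ := inf{n ∈ ℕ : X_n ∈ H₋} satisfies ℙ_x(τ̂ < ∞) = 1 for every x ∈ S. Then τ̂ is optimal for the reward g: for every x ∈ S, E_x[g(X_{τ̂})] = sup over stopping times τ of E_x[g(X_τ)]. -/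
open MeasureTheory

section Helpers
open Filter Topology

/-- `φ` depends only on the coordinates `0,…,n`. -/
def DepOn {S β : Type*} (n : ℕ) (φ : (ℕ → S) → β) : Prop :=
  ∀ ω ω' : ℕ → S, (∀ i ≤ n, ω i = ω' i) → φ ω = φ ω'

/-- Extension of a finite path to an infinite one. -/
def extPath {S : Type*} (n : ℕ) (p : Fin (n + 1) → S) : ℕ → S :=
  fun i => p ⟨min i n, by omega⟩

/-- Restriction of an infinite path. -/
def resPath {S : Type*} (n : ℕ) (ω : ℕ → S) : Fin (n + 1) → S := fun i => ω i

theorem ext_res {S : Type*} (n : ℕ) (ω : ℕ → S) : ∀ i ≤ n, extPath n (resPath n ω) i = ω i := by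
  intro i hi
  simp [extPath, resPath, hi]

theorem agree_iff {S : Type*} (n : ℕ) (ω : ℕ → S) (p : Fin (n + 1) → S) :
    (∀ i ≤ n, ω i = extPath n p i) ↔ p = resPath n ω := by
  constructor
  · intro h
    funext i
    have h1 : (i : ℕ) ≤ n := by omega
    have := h i h1
    simp [extPath, h1] at this
    simp [resPath, this]
  · rintro rfl i hi
    exact (ext_res n ω i hi).symm

theorem DepOn.measurable {S β : Type*} [Fintype S] [MeasurableSpace S]
    [MeasurableSingletonClass S] [MeasurableSpace β] {n : ℕ} {φ : (ℕ → S) → β} (h : DepOn n φ) :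
    Measurable φ := by
  have h1 : φ = (fun p => φ (extPath n p)) ∘ resPath n := by
    funext ω
    exact h _ _ (fun i hi => (ext_res n ω i hi).symm)
  rw [h1]
  refine Measurable.comp (Measurable.of_discrete) ?_
  exact measurable_pi_lambda _ (fun i => measurable_pi_apply _)

theorem DepOn.integrable {S : Type*} [Fintype S] [MeasurableSpace S]
    [MeasurableSingletonClass S] {n : ℕ} {φ : (ℕ → S) → ℝ} (h : DepOn n φ)
    (μ : Measure (ℕ → S)) [IsProbabilityMeasure μ] : Integrable φ μ := by
  refine Integrable.of_bound h.measurable.aestronglyMeasurable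
    (∑ p : Fin (n + 1) → S, ‖φ (extPath n p)‖) (Eventually.of_forall fun ω => ?_)
  rw [h ω _ (fun i hi => (ext_res n ω i hi).symm)]
  exact Finset.single_le_sum (f := fun p => ‖φ (extPath n p)‖) (fun _ _ => norm_nonneg _)
    (Finset.mem_univ _)

theorem DepOn.mono {S β : Type*} {m n : ℕ} (hmn : m ≤ n) {φ : (ℕ → S) → β} (h : DepOn m φ) :
    DepOn n φ := fun ω ω' hh => h ω ω' (fun i hi => hh i (hi.trans hmn))

theorem depOn_coord {S β : Type*} {n : ℕ} (f : S → β) : DepOn n (fun ω : ℕ → S => f (ω n)) :=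
  fun ω ω' hh => by simp only [hh n le_rfl]

theorem DepOn.mul {S : Type*} {n : ℕ} {φ ψ : (ℕ → S) → ℝ} (h : DepOn n φ) (h' : DepOn n ψ) :
    DepOn n (fun ω => φ ω * ψ ω) :=
  fun ω ω' hh => by simp only [h ω ω' hh, h' ω ω' hh]

/-- integral of a function of finitely many coordinates -/
theorem DepOn.integral {S : Type*} [Fintype S] [MeasurableSpace S]
    [MeasurableSingletonClass S] {n : ℕ} {φ : (ℕ → S) → ℝ} (h : DepOn n φ)
    (μ : Measure (ℕ → S)) [IsProbabilityMeasure μ] :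
    ∫ ω, φ ω ∂μ = ∑ p : Fin (n + 1) → S,
      φ (extPath n p) * μ.real {ω | ∀ i ≤ n, ω i = extPath n p i} := by
  classical
  have hm : ∀ p : Fin (n + 1) → S, MeasurableSet {ω : ℕ → S | ∀ i ≤ n, ω i = extPath n p i} := by
    intro p
    have : DepOn n (fun ω : ℕ → S => ∀ i ≤ n, ω i = extPath n p i) := by
      intro ω ω' hh
      refine propext (forall_congr' fun i => forall_congr' fun hi => ?_)
      rw [hh i hi]
    exact measurableSet_setOf.2 this.measurable
  have h1 : ∀ ω, φ ω = ∑ p : Fin (n + 1) → S,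
      ({ω | ∀ i ≤ n, ω i = extPath n p i} : Set (ℕ → S)).indicator
        (fun _ => φ (extPath n p)) ω := by
    intro ω
    simp only [Set.indicator_apply, Set.mem_setOf_eq, agree_iff]
    rw [Finset.sum_ite_eq' Finset.univ (resPath n ω)]
    simp only [Finset.mem_univ, if_true]
    exact h ω _ (fun i hi => (ext_res n ω i hi).symm)
  rw [integral_congr_ae (Eventually.of_forall h1), integral_finset_sum]
  · refine Finset.sum_congr rfl fun p _ => ?_
    rw [integral_indicator_const _ (hm p), smul_eq_mul, mul_comm]
  · intro p _
    exact (integrable_const _).indicator (hm p)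

theorem markov_step {S : Type*} [Fintype S] [DecidableEq S] [MeasurableSpace S]
    [MeasurableSingletonClass S]
    (P : S → S → ℝ) (hP0 : ∀ x y, 0 ≤ P x y)
    (μ : Measure (ℕ → S)) [IsProbabilityMeasure μ] (x : S)
    (hMarkov : ∀ (n : ℕ) (path : ℕ → S),
      μ {ω | ∀ i ≤ n, ω i = path i}
        = ENNReal.ofReal ((if path 0 = x then (1:ℝ) else 0) *
            ∏ i ∈ Finset.range n, P (path i) (path (i + 1))))
    (n : ℕ) (φ : (ℕ → S) → ℝ) (hφ : DepOn n φ) (f : S → ℝ) :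
    ∫ ω, φ ω * f (ω (n + 1)) ∂μ = ∫ ω, φ ω * ∑ z, P (ω n) z * f z ∂μ := by
  have hr : ∀ (n : ℕ) (path : ℕ → S), μ.real {ω | ∀ i ≤ n, ω i = path i}
        = (if path 0 = x then (1:ℝ) else 0) *
            ∏ i ∈ Finset.range n, P (path i) (path (i + 1)) := by
    intro n path
    rw [Measure.real, hMarkov, ENNReal.toReal_ofReal]
    refine mul_nonneg (by split_ifs <;> norm_num) (Finset.prod_nonneg fun i _ => hP0 _ _)
  rw [DepOn.integral (n := n + 1) ((hφ.mono (Nat.le_succ n)).mul (depOn_coord f)) μ,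
    DepOn.integral (n := n) (hφ.mul (depOn_coord (fun s => ∑ z, P s z * f z))) μ]
  simp only [hr]
  rw [← (Fin.snocEquiv (fun _ : Fin (n + 2) => S)).sum_comp, Fintype.sum_prod_type,
    Finset.sum_comm]
  refine Finset.sum_congr rfl fun p _ => ?_
  have e1 : ∀ y : S, ∀ i ≤ n,
      extPath (n + 1) (Fin.snocEquiv (fun _ : Fin (n + 2) => S) (y, p)) i = extPath n p i := by
    intro y i hi
    have h2 : i < n + 1 := by omega
    have h3 : i ≤ n + 1 := by omega
    simp [extPath, Fin.snocEquiv, Fin.snoc, hi, h2, h3]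
  have e2 : ∀ y : S,
      extPath (n + 1) (Fin.snocEquiv (fun _ : Fin (n + 2) => S) (y, p)) (n + 1) = y := by
    intro y
    simp [extPath, Fin.snocEquiv, Fin.snoc]
  rw [Finset.mul_sum, Finset.sum_mul]
  refine Finset.sum_congr rfl fun y _ => ?_
  rw [hφ _ _ (e1 y), e2 y, e1 y 0 (Nat.zero_le _), Finset.prod_range_succ, e2 y, e1 y n le_rfl]
  rw [Finset.prod_congr rfl (g := fun i => P (extPath n p i) (extPath n p (i + 1)))]
  · ring
  · intro i hi
    have := Finset.mem_range.1 hi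
    rw [e1 y i (by omega), e1 y (i + 1) (by omega)]

/-- finite-adaptedness part of being a stopping time -/
def Adapt {S : Type*} (τ : (ℕ → S) → ℕ∞) : Prop :=
  ∀ (n : ℕ) (ω ω' : ℕ → S), (∀ i ≤ n, ω i = ω' i) → τ ω = (n : ℕ∞) → τ ω' = (n : ℕ∞)

theorem Adapt.dep {S : Type*} {τ : (ℕ → S) → ℕ∞} (h : Adapt τ) (n : ℕ) :
    DepOn n (fun ω => (n : ℕ∞) < τ ω) := by
  have key : ∀ ω ω' : ℕ → S, (∀ i ≤ n, ω i = ω' i) → τ ω ≤ n → τ ω' ≤ n := by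
    intro ω ω' hh hle
    obtain ⟨m, hm⟩ := ENat.ne_top_iff_exists.1 (ne_top_of_le_ne_top (ENat.natCast_ne_top n) hle)
    have hmn : m ≤ n := by rw [← hm] at hle; exact_mod_cast hle
    rw [h m ω ω' (fun i hi => hh i (hi.trans hmn)) hm.symm]
    exact_mod_cast hmn
  intro ω ω' hh
  refine propext ?_
  beta_reduce
  rw [← not_le, ← not_le, not_iff_not]
  exact ⟨key ω ω' hh, key ω' ω (fun i hi => (hh i hi).symm)⟩

open Classical in
/-- stopped reward -/
noncomputable def stopVal {S : Type*} (g : S → ℝ) (τ : (ℕ → S) → ℕ∞) (n : ℕ) (ω : ℕ → S) : ℝ :=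
  g (ω (min (τ ω) n).toNat)

open Classical in
/-- indicator of `n < τ` -/
noncomputable def aliveInd {S : Type*} (τ : (ℕ → S) → ℕ∞) (n : ℕ) (ω : ℕ → S) : ℝ :=
  if (n : ℕ∞) < τ ω then 1 else 0

theorem Adapt.depInd {S : Type*} {τ : (ℕ → S) → ℕ∞} (h : Adapt τ) (n : ℕ) :
    DepOn n (aliveInd τ n) := by
  intro ω ω' hh
  have := h.dep n ω ω' hh
  simp only [aliveInd]
  simp only [eq_iff_iff] at this
  simp only [this]

theorem stopVal_succ {S : Type*} (g : S → ℝ) (τ : (ℕ → S) → ℕ∞) (n : ℕ) (ω : ℕ → S) :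
    stopVal g τ (n + 1) ω =
      stopVal g τ n ω + aliveInd τ n ω * (g (ω (n + 1)) - g (ω n)) := by
  unfold stopVal aliveInd
  split_ifs with h
  · have h1 : ((n + 1 : ℕ) : ℕ∞) ≤ τ ω := by
      push_cast
      exact Order.add_one_le_of_lt h
    rw [min_eq_right h1, min_eq_right h.le]
    simp only [ENat.toNat_natCast]
    ring
  · have h1 := not_lt.1 h
    have h2 : τ ω ≤ ((n + 1 : ℕ) : ℕ∞) := h1.trans (by exact_mod_cast Nat.le_succ n)
    rw [min_eq_left h1, min_eq_left h2]
    ring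

theorem stopVal_zero {S : Type*} (g : S → ℝ) (τ : (ℕ → S) → ℕ∞) (ω : ℕ → S) :
    stopVal g τ 0 ω = g (ω 0) := by
  simp [stopVal]

theorem Adapt.depStop {S : Type*} {τ : (ℕ → S) → ℕ∞} (h : Adapt τ) (g : S → ℝ) (n : ℕ) :
    DepOn n (stopVal g τ n) := by
  induction n with
  | zero =>
    intro ω ω' hh
    rw [stopVal_zero, stopVal_zero, hh 0 le_rfl]
  | succ n ih =>
    intro ω ω' hh
    have hh' : ∀ i ≤ n, ω i = ω' i := fun i hi => hh i (by omega)
    rw [stopVal_succ, stopVal_succ, ih ω ω' hh', h.depInd n ω ω' hh', hh' n le_rfl,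
      hh (n + 1) le_rfl]

theorem Adapt.tendsto {S : Type*} [Fintype S] [MeasurableSpace S]
    [MeasurableSingletonClass S] {τ : (ℕ → S) → ℕ∞} (h : Adapt τ) (g : S → ℝ)
    (μ : Measure (ℕ → S)) [IsProbabilityMeasure μ] (hfin : μ {ω | τ ω ≠ ⊤} = 1) :
    Tendsto (fun n => ∫ ω, stopVal g τ n ω ∂μ) atTop (𝓝 (∫ ω, g (ω (τ ω).toNat) ∂μ)) := by
  have hm : MeasurableSet {ω | τ ω ≠ ⊤} := by
    have : {ω | τ ω ≠ ⊤} = ⋃ n : ℕ, {ω | (n : ℕ∞) < τ ω}ᶜ := by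
      ext ω
      simp only [Set.mem_setOf_eq, Set.mem_iUnion, Set.mem_compl_iff, not_lt]
      constructor
      · intro hne
        obtain ⟨m, hm⟩ := ENat.ne_top_iff_exists.1 hne
        exact ⟨m, hm.symm.le⟩
      · rintro ⟨n, hn⟩
        exact ne_top_of_le_ne_top (ENat.natCast_ne_top n) hn
    rw [this]
    exact MeasurableSet.iUnion fun n => (measurableSet_setOf.2 (h.dep n).measurable).compl
  have hae : ∀ᵐ ω ∂μ, τ ω ≠ ⊤ := (mem_ae_iff_prob_eq_one hm).2 hfin
  refine tendsto_integral_of_dominated_convergence (fun _ => ∑ s, ‖g s‖)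
    (fun n => (h.depStop g n).measurable.aestronglyMeasurable) (integrable_const _)
    (fun n => Eventually.of_forall fun ω => ?_) ?_
  · exact Finset.single_le_sum (f := fun s => ‖g s‖) (fun _ _ => norm_nonneg _)
      (Finset.mem_univ _)
  · filter_upwards [hae] with ω hω
    obtain ⟨m, hm⟩ := ENat.ne_top_iff_exists.1 hω
    refine tendsto_const_nhds.congr' ?_
    filter_upwards [eventually_ge_atTop m] with n hn
    have : τ ω ≤ n := by rw [← hm]; exact_mod_cast hn
    simp only [stopVal, min_eq_left this]

end Helpers

/-- let `H₊ = {x | (P g)(x) > g(x)}` and `H₋ = {x | (P g)(x) ≤ g(x)}`.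
If `P x y = 0` whenever `x ∈ H₋` and `y ∈ H₊` (the set `H₋` cannot be left for
`H₊`), and the first entrance time `τ̂ = inf {n | X_n ∈ H₋}` is a.s. finite under
every `ℙ x`, then `τ̂` is optimal for the reward `g`:
`E_x[g(X_{τ̂})] = sup_τ E_x[g(X_τ)]` for every `x`, the supremum running over all
stopping times.  Here `ℙ x` is the law of the Markov chain with stochastic
transition matrix `P` started at `x`, characterized by its cylinder
distributions. -/
theorem stmt8 {S : Type*} [Fintype S] [DecidableEq S] [MeasurableSpace S]
    [MeasurableSingletonClass S]
    (P : S → S → ℝ) (hP0 : ∀ x y, 0 ≤ P x y) (hP1 : ∀ x, ∑ y, P x y = 1)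
    (ℙ : S → Measure (ℕ → S)) (hprob : ∀ x, IsProbabilityMeasure (ℙ x))
    (hMarkov : ∀ (x : S) (n : ℕ) (path : ℕ → S),
      ℙ x {ω | ∀ i ≤ n, ω i = path i}
        = ENNReal.ofReal ((if path 0 = x then (1:ℝ) else 0) *
            ∏ i ∈ Finset.range n, P (path i) (path (i + 1))))
    (g : S → ℝ)
    (hno_escape : ∀ x y : S, (∑ z, P x z * g z ≤ g x) → (g y < ∑ z, P y z * g z) →
      P x y = 0)
    (τhat : (ℕ → S) → ℕ∞)
    (hτhat : ∀ ω, τhat ω =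
      sInf {n : ℕ∞ | ∃ m : ℕ, (m : ℕ∞) = n ∧ ∑ z, P (ω m) z * g z ≤ g (ω m)})
    (hfin : ∀ x, ℙ x {ω | τhat ω ≠ ⊤} = 1) :
    ∀ x : S,
      ∫ ω, g (ω (τhat ω).toNat) ∂(ℙ x)
        = ⨆ τ : {τ : (ℕ → S) → ℕ∞ // IsStopTime ℙ τ},
            ∫ ω, g (ω (τ.1 ω).toNat) ∂(ℙ x) := by
  have hlt : ∀ (n : ℕ) ω, (n : ℕ∞) < τhat ω ↔ ∀ m ≤ n, g (ω m) < ∑ z, P (ω m) z * g z := by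
    intro n ω
    constructor
    · intro h m hm
      by_contra hc
      have h1 : τhat ω ≤ m := by
        rw [hτhat]
        exact sInf_le ⟨m, rfl, not_lt.1 hc⟩
      have h2 : (m : ℕ∞) ≤ n := by exact_mod_cast hm
      exact absurd h (not_lt.2 (h1.trans h2))
    · intro h
      have h1 : ((n + 1 : ℕ) : ℕ∞) ≤ τhat ω := by
        rw [hτhat]
        refine le_sInf ?_
        rintro _ ⟨m, rfl, hm⟩
        have : ¬ m ≤ n := fun hc => absurd (h m hc) (not_lt.2 hm)
        exact_mod_cast (by omega : n + 1 ≤ m)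
      exact lt_of_lt_of_le (by exact_mod_cast Nat.lt_succ_self n) h1
  have hAhat : Adapt τhat := by
    have hdep : ∀ (n k : ℕ) (ω ω' : ℕ → S), k ≤ n → (∀ i ≤ n, ω i = ω' i) →
        ((k : ℕ∞) < τhat ω ↔ (k : ℕ∞) < τhat ω') := by
      intro n k ω ω' hk hh
      rw [hlt, hlt]
      refine forall_congr' fun m => forall_congr' fun hm => ?_
      rw [hh m (hm.trans hk)]
    intro n ω ω' hh hn
    apply le_antisymm
    · rw [← not_lt, ← hdep n n ω ω' le_rfl hh, hn]
      exact lt_irrefl _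
    · rcases n with _ | k
      · simp
      · have h1 := (hdep (k + 1) k ω ω' (Nat.le_succ k) hh).1
          (by rw [hn]; exact_mod_cast Nat.lt_succ_self k)
        push_cast
        exact Order.add_one_le_of_lt h1
  intro x
  haveI := hprob x
  have hstep := markov_step P hP0 (ℙ x) x (hMarkov x)
  have hstay : ∀ n : ℕ, ∀ᵐ ω ∂(ℙ x), (∑ z, P (ω n) z * g z ≤ g (ω n)) →
      (∑ z, P (ω (n + 1)) z * g z ≤ g (ω (n + 1))) := by
    intro n
    classical
    let a : S → ℝ := fun s => if ∑ z, P s z * g z ≤ g s then 1 else 0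
    let b : S → ℝ := fun s => if ∑ z, P s z * g z ≤ g s then 0 else 1
    have ha : ∀ s, 0 ≤ a s := fun s => by simp only [a]; split_ifs <;> norm_num
    have hb : ∀ s, 0 ≤ b s := fun s => by simp only [b]; split_ifs <;> norm_num
    have h0 := hstep n (fun ω => a (ω n)) (depOn_coord a) b
    have hz : ∀ s, a s * ∑ z, P s z * b z = 0 := by
      intro s
      by_cases hs : ∑ z, P s z * g z ≤ g s
      · have : ∑ z, P s z * b z = 0 := by
          refine Finset.sum_eq_zero fun z _ => ?_
          by_cases hzz : ∑ w, P z w * g w ≤ g z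
          · simp [b, hzz]
          · rw [hno_escape s z hs (not_le.1 hzz), zero_mul]
        rw [this, mul_zero]
      · simp [a, hs]
    simp only [hz, integral_zero] at h0
    have hint : Integrable (fun ω : ℕ → S => a (ω n) * b (ω (n + 1))) (ℙ x) :=
      DepOn.integrable (n := n + 1)
        (((depOn_coord a).mono (Nat.le_succ n)).mul (depOn_coord b)) _
    rw [integral_eq_zero_iff_of_nonneg (fun ω => mul_nonneg (ha _) (hb _)) hint] at h0
    filter_upwards [h0] with ω hω h1
    by_contra hc
    simp [a, b, h1, hc] at hω
  have hin : ∀ᵐ ω ∂(ℙ x), ∀ n : ℕ, τhat ω ≤ n → ∑ z, P (ω n) z * g z ≤ g (ω n) := by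
    filter_upwards [ae_all_iff.2 hstay] with ω hω n hn
    have h1 := (hlt n ω).not.1 (not_lt.2 hn)
    push Not at h1
    obtain ⟨m, hm, hm'⟩ := h1
    induction n, hm using Nat.le_induction with
    | base => exact hm'
    | succ k hk ih =>
      apply hω
      have hk' : ¬ (k : ℕ∞) < τhat ω := fun hc => absurd ((hlt k ω).1 hc m hk) (not_lt.2 hm')
      exact ih (not_lt.1 hk')
  have hmono : ∀ τ : (ℕ → S) → ℕ∞, Adapt τ → ∀ n : ℕ,
      ∫ ω, stopVal g τ n ω ∂(ℙ x) ≤ ∫ ω, stopVal g τhat n ω ∂(ℙ x) := by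
    intro τ hτ n
    have hI : ∀ (σ : (ℕ → S) → ℕ∞), Adapt σ → ∀ n : ℕ, 
        ∫ ω, stopVal g σ (n + 1) ω ∂(ℙ x) = ∫ ω, stopVal g σ n ω ∂(ℙ x) +
          ∫ ω, aliveInd σ n ω * (∑ z, P (ω n) z * g z - g (ω n)) ∂(ℙ x) := by
      intro σ hσ n
      have i0 := DepOn.integrable (hσ.depStop g n) (ℙ x)
      have i1 : Integrable (fun ω => aliveInd σ n ω * g (ω (n + 1))) (ℙ x) :=
        DepOn.integrable (((hσ.depInd n).mono (Nat.le_succ n)).mul (depOn_coord g)) _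
      have i2 : Integrable (fun ω => aliveInd σ n ω * g (ω n)) (ℙ x) :=
        DepOn.integrable ((hσ.depInd n).mul (depOn_coord g)) _
      have i3 : Integrable (fun ω => aliveInd σ n ω * ∑ z, P (ω n) z * g z) (ℙ x) :=
        DepOn.integrable ((hσ.depInd n).mul (depOn_coord (fun s => ∑ z, P s z * g z))) _
      have i4 : Integrable (fun ω => aliveInd σ n ω * g (ω (n + 1)) - aliveInd σ n ω * g (ω n))
          (ℙ x) := i1.sub i2
      simp only [stopVal_succ, mul_sub]
      rw [integral_add i0 i4, integral_sub i1 i2, integral_sub i3 i2,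
        hstep n _ (hσ.depInd n) g]
    induction n with
    | zero => simp only [stopVal_zero]; exact le_rfl
    | succ n ih =>
      rw [hI τ hτ, hI τhat hAhat]
      refine add_le_add ih ?_
      refine integral_mono_ae
        (DepOn.integrable ((hτ.depInd n).mul
          (depOn_coord (fun s => ∑ z, P s z * g z - g s))) _)
        (DepOn.integrable ((hAhat.depInd n).mul
          (depOn_coord (fun s => ∑ z, P s z * g z - g s))) _) ?_
      filter_upwards [hin] with ω hω
      by_cases hc : (n : ℕ∞) < τhat ω
      · have h1 := (hlt n ω).1 hc n le_rfl
        simp only [aliveInd, hc, if_true]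
        split_ifs <;> linarith
      · have h1 := hω n (not_lt.1 hc)
        simp only [aliveInd, hc, if_false]
        split_ifs <;> linarith
  have hle : ∀ τ : {τ : (ℕ → S) → ℕ∞ // IsStopTime ℙ τ},
      ∫ ω, g (ω (τ.1 ω).toNat) ∂(ℙ x) ≤ ∫ ω, g (ω (τhat ω).toNat) ∂(ℙ x) := by
    rintro ⟨τ, hτ, hτf⟩
    exact le_of_tendsto_of_tendsto' (Adapt.tendsto hτ g (ℙ x) (hτf x))
      (hAhat.tendsto g (ℙ x) (hfin x)) (hmono τ hτ)
  haveI : Nonempty {τ : (ℕ → S) → ℕ∞ // IsStopTime ℙ τ} := ⟨⟨τhat, hAhat, hfin⟩⟩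
  refine le_antisymm ?_ (ciSup_le hle)
  exact le_ciSup (f := fun τ : {τ : (ℕ → S) → ℕ∞ // IsStopTime ℙ τ} =>
    ∫ ω, g (ω (τ.1 ω).toNat) ∂(ℙ x)) ⟨_, by rintro _ ⟨τ, rfl⟩; exact hle τ⟩ ⟨τhat, hAhat, hfin⟩
end

section
/- For all integers 1 ≤ i < j ≤ N, the probability that σ has a record at time j and no record at any time m with i < m < j equals i/(j(j−1)); moreover this event is independent of the event that σ has a record at time i. In addition, for 1 ≤ i ≤ N, the probability that σ has no record at any time m > i equals i/N. -/
/-- `σ` (a permutation of `{1,…,N}`, encoded as `Equiv.Perm (Fin N)` with time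
`t ∈ {1,…,N}` corresponding to index `t - 1 : Fin N`) has a record at time `t`:
`σ(t) > σ(k)` for all `1 ≤ k < t` (so `t = 1` is always a record). -/
def RecordAt {N : ℕ} (σ : Equiv.Perm (Fin N)) (t : ℕ) : Prop :=
  ∃ h : 1 ≤ t ∧ t ≤ N, ∀ k : ℕ, ∀ hk : k < t - 1, σ ⟨k, by omega⟩ < σ ⟨t - 1, by omega⟩


/-- Insert a new last value `p`, keeping the relative order of the earlier ones. -/
def insLast {n : ℕ} (p : Fin (n + 1)) (τ : Equiv.Perm (Fin n)) : Equiv.Perm (Fin (n + 1)) :=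
  (finSuccEquivLast.trans (Equiv.optionCongr τ)).trans (finSuccEquiv' p).symm

theorem insLast_last {n : ℕ} (p : Fin (n + 1)) (τ : Equiv.Perm (Fin n)) :
    insLast p τ (Fin.last n) = p := by
  simp [insLast]

theorem insLast_castSucc {n : ℕ} (p : Fin (n + 1)) (τ : Equiv.Perm (Fin n)) (k : Fin n) :
    insLast p τ k.castSucc = p.succAbove (τ k) := by
  simp [insLast]

theorem insLast_bij (n : ℕ) :
    Function.Bijective (fun x : Fin (n + 1) × Equiv.Perm (Fin n) => insLast x.1 x.2) := by
  rw [Fintype.bijective_iff_injective_and_card]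
  constructor
  · rintro ⟨p, τ⟩ ⟨q, ρ⟩ h
    simp only at h
    have hpq : p = q := by
      rw [← insLast_last p τ, h, insLast_last]
    subst hpq
    have : τ = ρ := by
      ext k
      have h1 := insLast_castSucc p τ k
      rw [h, insLast_castSucc] at h1
      rw [Fin.succAbove_right_injective h1]
    rw [this]
  · simp [Fintype.card_perm, Nat.factorial_succ]

theorem record_ins_le {n : ℕ} (p : Fin (n + 1)) (τ : Equiv.Perm (Fin n)) (t : ℕ) (ht : t ≤ n) :
    RecordAt (insLast p τ) t ↔ RecordAt τ t := by
  constructor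
  · rintro ⟨⟨h1, h2⟩, h⟩
    refine ⟨⟨h1, ht⟩, fun k hk => ?_⟩
    have h3 := h k hk
    have e1 := insLast_castSucc p τ ⟨k, by omega⟩
    have e2 := insLast_castSucc p τ ⟨t - 1, by omega⟩
    simp only [Fin.castSucc_mk] at e1 e2
    rw [e1, e2] at h3
    exact (Fin.strictMono_succAbove p).lt_iff_lt.1 h3
  · rintro ⟨⟨h1, h2⟩, h⟩
    refine ⟨⟨h1, by omega⟩, fun k hk => ?_⟩
    have h3 := h k hk
    have e1 := insLast_castSucc p τ ⟨k, by omega⟩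
    have e2 := insLast_castSucc p τ ⟨t - 1, by omega⟩
    simp only [Fin.castSucc_mk] at e1 e2
    rw [e1, e2]
    exact (Fin.strictMono_succAbove p).lt_iff_lt.2 h3

theorem record_ins_last {n : ℕ} (p : Fin (n + 1)) (τ : Equiv.Perm (Fin n)) :
    RecordAt (insLast p τ) (n + 1) ↔ p = Fin.last n := by
  have e2 := insLast_last p τ
  constructor
  · rintro ⟨h0, h⟩
    by_contra hp
    have hlt : p.val < n := Fin.val_lt_last hp
    have h3 := h (τ.symm ⟨p.val, hlt⟩).val (by simp)
    have e1 := insLast_castSucc p τ (τ.symm ⟨p.val, hlt⟩)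
    have h4 : insLast p τ (τ.symm ⟨p.val, hlt⟩).castSucc < insLast p τ (Fin.last n) := h3
    rw [e1, e2, Equiv.apply_symm_apply, Fin.succAbove_lt_iff_castSucc_lt] at h4
    exact absurd h4 (lt_irrefl _)
  · intro hp
    refine ⟨⟨by omega, le_refl _⟩, fun k hk => ?_⟩
    have hk' : k < n := by simpa using hk
    have e1 := insLast_castSucc p τ ⟨k, hk'⟩
    change insLast p τ (Fin.castSucc ⟨k, hk'⟩) < insLast p τ (Fin.last n)
    rw [e1, e2, hp, Fin.succAbove_last]
    exact Fin.castSucc_lt_last _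

open Classical in
/-- Number of ways to place the value at time `t + 1` respecting the constraint `P (t + 1)`. -/
noncomputable def wt (P : ℕ → Prop → Prop) (t : ℕ) : ℕ :=
  (if P (t + 1) True then 1 else 0) + (if P (t + 1) False then t else 0)

theorem card_last (P : ℕ → Prop → Prop) (n : ℕ) :
    Nat.card {p : Fin (n + 1) // P (n + 1) (p = Fin.last n)} = wt P n := by
  classical
  rw [Nat.card_eq_fintype_card, Fintype.card_subtype, Finset.card_filter, Fin.sum_univ_castSucc]
  have h : ∀ x : Fin n, (x.castSucc = Fin.last n) = False := fun x =>
    eq_false (Fin.castSucc_lt_last x).ne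
  simp only [h, wt]
  rw [add_comm]
  by_cases hF : P (n + 1) False <;> simp [hF]

theorem card_main (P : ℕ → Prop → Prop) (n : ℕ) :
    Nat.card {σ : Equiv.Perm (Fin n) // ∀ t, 1 ≤ t → t ≤ n → P t (RecordAt σ t)}
      = ∏ t ∈ Finset.range n, wt P t := by
  induction n with
  | zero =>
    have : ∀ σ : Equiv.Perm (Fin 0), ∀ t, 1 ≤ t → t ≤ 0 → P t (RecordAt σ t) := by
      intro σ t h1 h2; omega
    rw [Nat.card_congr (Equiv.subtypeUnivEquiv this)]
    simp
  | succ n ih =>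
    rw [Finset.prod_range_succ, ← ih, ← card_last, mul_comm, ← Nat.card_prod]
    refine (Nat.card_congr ?_).symm
    refine (Equiv.subtypeProdEquivProd (p := fun p : Fin (n + 1) => P (n + 1) (p = Fin.last n))
      (q := fun τ : Equiv.Perm (Fin n) => ∀ t, 1 ≤ t → t ≤ n → P t (RecordAt τ t))).symm.trans ?_
    refine (Equiv.ofBijective _ (insLast_bij n)).subtypeEquiv ?_
    rintro ⟨p, τ⟩
    simp only [Equiv.ofBijective_apply]
    constructor
    · rintro ⟨h1, h2⟩ t ht1 ht2
      rcases Nat.lt_or_ge n t with h | h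
      · obtain rfl : t = n + 1 := by omega
        rw [record_ins_last]; exact h1
      · rw [record_ins_le _ _ _ h]; exact h2 t ht1 h
    · intro h
      refine ⟨?_, fun t ht1 ht2 => ?_⟩
      · have := h (n + 1) (by omega) le_rfl
        rwa [record_ins_last] at this
      · have := h t ht1 (by omega)
        rwa [record_ins_le _ _ _ ht2] at this

theorem prod_free (P : ℕ → Prop → Prop) (i : ℕ) (h : ∀ t, t < i → wt P t = t + 1) :
    ∏ t ∈ Finset.range i, wt P t = i.factorial := by
  rw [← Finset.prod_range_add_one_eq_factorial]
  exact Finset.prod_congr rfl fun t ht => h t (Finset.mem_range.1 ht)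

theorem prod_gap (P : ℕ → Prop → Prop) (i n : ℕ) (hn : i ≤ n)
    (h : ∀ t, t < i → wt P t = t + 1) (h' : ∀ t, i ≤ t → t < n → wt P t = t) :
    (∏ t ∈ Finset.range n, wt P t) * n = i * n.factorial := by
  induction n, hn using Nat.le_induction with
  | base => rw [prod_free P i h, mul_comm]
  | succ n hn ih =>
    rw [Finset.prod_range_succ, h' n hn (by omega), ih fun t h1 h2 => h' t h1 (by omega),
      Nat.factorial_succ]
    ring

theorem prod_after (P : ℕ → Prop → Prop) (i j n : ℕ) (hij : i ≤ j) (hn : j + 1 ≤ n)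
    (h : ∀ t, t < i → wt P t = t + 1) (h' : ∀ t, i ≤ t → t < j → wt P t = t)
    (hj : wt P j = 1) (h'' : ∀ t, j < t → wt P t = t + 1) :
    (∏ t ∈ Finset.range n, wt P t) * ((j + 1) * j) = i * n.factorial := by
  induction n, hn using Nat.le_induction with
  | base =>
    have := prod_gap P i j hij h h'
    rw [Finset.prod_range_succ, hj, Nat.factorial_succ]
    linear_combination (j + 1) * this
  | succ n hn ih =>
    rw [Finset.prod_range_succ, h'' n (by omega), Nat.factorial_succ]
    linear_combination (n + 1) * ih

theorem prod_change (P Q : ℕ → Prop → Prop) (i n : ℕ) (hi : i < n)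
    (h : ∀ t, t ≠ i → wt P t = wt Q t) (hP : wt P i = i + 1) (hQ : wt Q i = 1) :
    (∏ t ∈ Finset.range n, wt Q t) * (i + 1) = ∏ t ∈ Finset.range n, wt P t := by
  rw [← Finset.mul_prod_erase _ _ (Finset.mem_range.2 hi),
    ← Finset.mul_prod_erase _ (wt P) (Finset.mem_range.2 hi), hP, hQ,
    Finset.prod_congr rfl fun t ht => h t (Finset.ne_of_mem_erase ht)]
  ring

theorem card_event {N : ℕ} (P : ℕ → Prop → Prop) (E : Equiv.Perm (Fin N) → Prop)
    (h : ∀ σ, E σ ↔ ∀ t, 1 ≤ t → t ≤ N → P t (RecordAt σ t)) :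
    Nat.card {σ : Equiv.Perm (Fin N) // E σ} = ∏ t ∈ Finset.range N, wt P t := by
  rw [← card_main]
  exact Nat.card_congr (Equiv.subtypeEquivRight h)

/-- for a uniformly random permutation `σ` of `{1,…,N}` and
`1 ≤ i < j ≤ N`: (a) the probability that `σ` has a record at time `j` and no
record at any time strictly between `i` and `j` equals `i/(j(j−1))`; (b) this
event is independent of the event that `σ` has a record at time `i`; (c) the
probability that `σ` has no record at any time `m > i` equals `i/N`.
Probabilities of events are expressed as `(number of permutations in the event) / N!`. -/
theorem stmt9 (N i j : ℕ) (hi : 1 ≤ i) (hij : i < j) (hjN : j ≤ N) :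
    ((Nat.card {σ : Equiv.Perm (Fin N) //
        RecordAt σ j ∧ ∀ m, i < m → m < j → ¬ RecordAt σ m} : ℝ) / (Nat.factorial N)
      = (i : ℝ) / ((j : ℝ) * ((j : ℝ) - 1))) ∧
    ((Nat.card {σ : Equiv.Perm (Fin N) //
        (RecordAt σ j ∧ ∀ m, i < m → m < j → ¬ RecordAt σ m) ∧ RecordAt σ i} : ℝ)
          / (Nat.factorial N)
      = ((Nat.card {σ : Equiv.Perm (Fin N) //
            RecordAt σ j ∧ ∀ m, i < m → m < j → ¬ RecordAt σ m} : ℝ) / (Nat.factorial N))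
        * ((Nat.card {σ : Equiv.Perm (Fin N) // RecordAt σ i} : ℝ) / (Nat.factorial N))) ∧
    ((Nat.card {σ : Equiv.Perm (Fin N) //
        ∀ m, i < m → m ≤ N → ¬ RecordAt σ m} : ℝ) / (Nat.factorial N)
      = (i : ℝ) / (N : ℝ)) := by
  obtain ⟨i, rfl⟩ : ∃ a, i = a + 1 := ⟨i - 1, by omega⟩
  obtain ⟨j, rfl⟩ : ∃ a, j = a + 1 := ⟨j - 1, by omega⟩
  let P1 : ℕ → Prop → Prop := fun t r => (t = j + 1 → r) ∧ (i + 1 < t → t < j + 1 → ¬ r)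
  let P2 : ℕ → Prop → Prop := fun t r => P1 t r ∧ (t = i + 1 → r)
  let P3 : ℕ → Prop → Prop := fun t r => t = i + 1 → r
  let P4 : ℕ → Prop → Prop := fun t r => i + 1 < t → ¬ r
  let P0 : ℕ → Prop → Prop := fun _ _ => True
  have c1 := card_event (N := N) P1
    (fun σ => RecordAt σ (j + 1) ∧ ∀ m, i + 1 < m → m < j + 1 → ¬ RecordAt σ m) (by
      intro σ
      constructor
      · rintro ⟨h1, h2⟩ t _ _
        exact ⟨fun e => e ▸ h1, h2 t⟩
      · intro h
        exact ⟨(h (j + 1) (by omega) hjN).1 rfl,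
          fun m h1 h2 => (h m (by omega) (by omega)).2 h1 h2⟩)
  have c2 := card_event (N := N) P2
    (fun σ => (RecordAt σ (j + 1) ∧ ∀ m, i + 1 < m → m < j + 1 → ¬ RecordAt σ m) ∧
      RecordAt σ (i + 1)) (by
      intro σ
      constructor
      · rintro ⟨⟨h1, h2⟩, h3⟩ t _ _
        exact ⟨⟨fun e => e ▸ h1, h2 t⟩, fun e => e ▸ h3⟩
      · intro h
        exact ⟨⟨(h (j + 1) (by omega) hjN).1.1 rfl,
          fun m h1 h2 => (h m (by omega) (by omega)).1.2 h1 h2⟩,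
          (h (i + 1) (by omega) (by omega)).2 rfl⟩)
  have c3 := card_event (N := N) P3 (fun σ => RecordAt σ (i + 1)) (by
      intro σ
      constructor
      · intro h3 t _ _ e
        exact e ▸ h3
      · intro h
        exact h (i + 1) (by omega) (by omega) rfl)
  have c4 := card_event (N := N) P4
    (fun σ => ∀ m, i + 1 < m → m ≤ N → ¬ RecordAt σ m) (by
      intro σ
      constructor
      · intro h t _ h2 h1
        exact h t h1 h2
      · intro h m h1 h2
        exact h m (by omega) h2 h1)
  have w1 : ∀ t, wt P1 t = if t = j then 1 else if i < t ∧ t < j then t else t + 1 := by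
    intro t
    by_cases h : t = j
    · simp [wt, P1, h]
    · by_cases h2 : i < t ∧ t < j
      · simp [wt, P1, h, h2.1, h2.2]
      · have h3 : i < t → ¬ t < j := fun a b => h2 ⟨a, b⟩
        have h4 : i < t → j ≤ t := fun a => not_lt.1 (h3 a)
        simp [wt, P1, h, h2, h4, add_comm]
  have w2 : ∀ t, wt P2 t = if t = i then 1 else wt P1 t := by
    intro t
    by_cases h : t = i
    · subst h
      have : t ≠ j := by omega
      simp [wt, P2, P1, this]
    · simp [wt, P2, h]
      congr
  have w3 : ∀ t, wt P3 t = if t = i then 1 else t + 1 := by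
    intro t
    by_cases h : t = i <;> simp [wt, P3, h, add_comm]
  have w4 : ∀ t, wt P4 t = if i < t then t else t + 1 := by
    intro t
    by_cases h : i < t
    · simp [wt, P4, h]
    · simp [wt, P4, h, add_comm]
  have w0 : ∀ t, wt P0 t = t + 1 := by
    intro t; simp [wt, P0, add_comm]
  have q1 := prod_after P1 (i + 1) j N (by omega) hjN
    (fun t ht => by rw [w1, if_neg (by omega), if_neg (by omega)])
    (fun t ht ht' => by rw [w1, if_neg (by omega), if_pos (by omega)])
    (by rw [w1, if_pos rfl])
    (fun t ht => by rw [w1, if_neg (by omega), if_neg (by omega)])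
  have q2 := prod_change P1 P2 i N (by omega) (fun t ht => by rw [w2, if_neg ht])
    (by rw [w1, if_neg (by omega), if_neg (by omega)]) (by rw [w2, if_pos rfl])
  have q3 := prod_change P0 P3 i N (by omega) (fun t ht => by rw [w3, if_neg ht, w0])
    (w0 i) (by rw [w3, if_pos rfl])
  rw [prod_free P0 N fun t _ => w0 t] at q3
  have q4 := prod_gap P4 (i + 1) N (by omega)
    (fun t ht => by rw [w4, if_neg (by omega)])
    (fun t ht ht' => by rw [w4, if_pos (by omega)])
  rw [← c1] at q1 q2
  rw [← c2] at q2
  rw [← c3] at q3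
  rw [← c4] at q4
  have hN : (N.factorial : ℝ) ≠ 0 := by exact_mod_cast N.factorial_ne_zero
  have hj0 : (j : ℝ) ≠ 0 := by exact_mod_cast (by omega : j ≠ 0)
  have hj1 : (j : ℝ) + 1 ≠ 0 := by exact_mod_cast (by omega : j + 1 ≠ 0)
  have hi1 : (i : ℝ) + 1 ≠ 0 := by exact_mod_cast (by omega : i + 1 ≠ 0)
  have hN0 : (N : ℝ) ≠ 0 := by exact_mod_cast (by omega : N ≠ 0)
  have r1 := congrArg (Nat.cast : ℕ → ℝ) q1
  have r2 := congrArg (Nat.cast : ℕ → ℝ) q2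
  have r3 := congrArg (Nat.cast : ℕ → ℝ) q3
  have r4 := congrArg (Nat.cast : ℕ → ℝ) q4
  clear q1 q2 q3 q4 c1 c2 c3 c4
  push_cast at r1 r2 r3 r4 ⊢
  refine ⟨?_, ?_, ?_⟩
  · rw [add_sub_cancel_right, div_eq_div_iff hN (mul_ne_zero hj1 hj0)]
    exact r1
  · rw [← r2, ← mul_div_mul_comm, div_eq_div_iff hN (mul_ne_zero hN hN)]
    rw [← r3]
    ring
  · rw [div_eq_div_iff hN hN0]
    exact r4
end

section
/- Fix an integer l with 2 ≤ l ≤ N and define the threshold stopping rule τ(l) as the smallest j ≥ l such that σ has a record at time j (undefined on the event that no such j exists). Then for every k with l ≤ k ≤ N, the probability that τ(l) is defined, τ(l) ≤ k, and σ(τ(l)) = N (the rule selects the maximum) equals Σ_{j=l}^{k} (l−1)/(N(j−1)). In particular the probability that the threshold-l rule selects the maximum is ((l−1)/N) Σ_{j=l}^{N} 1/(j−1). -/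
section Aux
open Finset
open scoped Classical

noncomputable def secA {N : ℕ} (t : Fin N) : Finset (Equiv.Perm (Fin N)) :=
  univ.filter fun σ => (σ t : ℕ) = N - 1

noncomputable def secB {N : ℕ} (t i : Fin N) : Finset (Equiv.Perm (Fin N)) :=
  univ.filter fun σ => (σ t : ℕ) = N - 1 ∧ ∀ m, m < t → σ m ≤ σ i

lemma secA_card_le {N : ℕ} (t t' : Fin N) : (secA t).card ≤ (secA t').card := by
  apply Finset.card_le_card_of_injOn (fun σ => σ * Equiv.swap t t')
  · intro σ hσ
    simp [secA] at hσ ⊢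
    exact hσ
  · intro σ _ τ _ h
    simpa using h

lemma secA_card {N : ℕ} (t : Fin N) : N * (secA t).card = N.factorial := by
  have hN : 0 < N := t.pos
  have h1 : (univ : Finset (Fin N)).biUnion secA = univ := by
    ext σ
    simp only [mem_biUnion, mem_univ, true_and, iff_true, secA, mem_filter]
    exact ⟨σ.symm ⟨N - 1, by omega⟩, by simp⟩
  have h2 : ((univ : Finset (Fin N)).biUnion secA).card = ∑ s : Fin N, (secA s).card := by
    apply card_biUnion
    intro a _ b _ hab
    rw [Function.onFun, Finset.disjoint_left]
    intro σ ha hb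
    simp only [secA, mem_filter, mem_univ, true_and] at ha hb
    exact hab (σ.injective (Fin.ext (ha.trans hb.symm)))
  rw [h1, sum_congr rfl (fun s _ => le_antisymm (secA_card_le s t) (secA_card_le t s))] at h2
  simp [Fintype.card_perm] at h2
  exact h2.symm

lemma secB_card_le {N : ℕ} (t i i' : Fin N) (hi : i < t) (hi' : i' < t) :
    (secB t i).card ≤ (secB t i').card := by
  apply Finset.card_le_card_of_injOn (fun σ => σ * Equiv.swap i i')
  · intro σ hσ
    simp only [secB, coe_filter, mem_univ, true_and, Set.mem_ofPred_eq] at hσ ⊢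
    refine ⟨?_, ?_⟩
    · rw [Equiv.Perm.mul_apply, Equiv.swap_apply_of_ne_of_ne hi.ne' hi'.ne']
      exact hσ.1
    · intro m hm
      rw [Equiv.Perm.mul_apply, Equiv.Perm.mul_apply, Equiv.swap_apply_right]
      apply hσ.2
      rw [Equiv.swap_apply_def]
      split_ifs <;> assumption
  · intro σ _ τ _ h
    simpa using h

lemma secB_disj {N : ℕ} (t : Fin N) (s : Finset (Fin N)) (hs : ∀ i ∈ s, i < t) :
    (s.biUnion (secB t)).card = ∑ i ∈ s, (secB t i).card := by
  apply card_biUnion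
  intro a ha b hb hab
  rw [Function.onFun, Finset.disjoint_left]
  intro σ h1 h2
  simp only [secB, mem_filter, mem_univ, true_and] at h1 h2
  exact hab (σ.injective (le_antisymm (h2.2 a (hs a ha)) (h1.2 b (hs b hb))))

lemma secB_exists {N : ℕ} (t : Fin N) (ht : 0 < (t : ℕ)) (σ : Equiv.Perm (Fin N)) :
    ∃ i, i < t ∧ ∀ m, m < t → σ m ≤ σ i := by
  have hne : (Iio t).Nonempty := ⟨⟨0, t.pos⟩, by simp [Fin.lt_def, ht]⟩
  obtain ⟨i, hi, h⟩ := exists_max_image (Iio t) σ hne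
  exact ⟨i, by simpa using hi, fun m hm => h m (by simpa using hm)⟩

lemma secB_card {N : ℕ} (t i : Fin N) (hi : i < t) : (t : ℕ) * (secB t i).card = (secA t).card := by
  have h1 : (Iio t).biUnion (secB t) = secA t := by
    ext σ
    simp only [mem_biUnion, mem_Iio, secA, secB, mem_filter, mem_univ, true_and]
    constructor
    · rintro ⟨j, _, h, _⟩
      exact h
    · intro h
      obtain ⟨j, hj, h'⟩ := secB_exists t (by have := Fin.lt_def.1 hi; omega) σ
      exact ⟨j, hj, h, h'⟩
  rw [← h1, secB_disj t _ (by simp), sum_congr rfl (fun s hs =>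
    le_antisymm (secB_card_le t s i (by simpa using hs) hi)
      (secB_card_le t i s hi (by simpa using hs)))]
  simp

/-- Event that the first record at or after time `l` occurs at time `j` and is the maximum. -/
noncomputable def secE (N l j : ℕ) : Finset (Equiv.Perm (Fin N)) :=
  univ.filter fun σ => ∃ h : 1 ≤ j ∧ j ≤ N,
    RecordAt σ j ∧ (∀ m, l ≤ m → m < j → ¬ RecordAt σ m) ∧ ((σ ⟨j - 1, by omega⟩ : ℕ) = N - 1)

lemma secE_eq (N l j : ℕ) (hl : 2 ≤ l) (hlj : l ≤ j) (hj : j ≤ N) :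
    secE N l j = (Iio (⟨l - 1, by omega⟩ : Fin N)).biUnion (secB ⟨j - 1, by omega⟩) := by
  ext σ
  simp only [mem_biUnion, mem_Iio, secE, secB, mem_filter, mem_univ, true_and]
  constructor
  · rintro ⟨h, h1, h2, h3⟩
    obtain ⟨i, hi, him⟩ := secB_exists (⟨j - 1, by omega⟩ : Fin N) (by simp; omega) σ
    refine ⟨i, ?_, h3, him⟩
    by_contra hc
    simp only [Fin.lt_def] at hc hi
    refine h2 (i + 1) (by omega) (by omega) ⟨⟨by omega, by omega⟩, ?_⟩
    intro k hk
    have hk' : k < i := by simpa using hk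
    have := him ⟨k, by omega⟩ (by simp [Fin.lt_def]; omega)
    simp only [Nat.add_sub_cancel]
    refine lt_of_le_of_ne this ?_
    intro he
    have := congrArg Fin.val (σ.injective he)
    simp at this
    omega
  · rintro ⟨i, hi, h3, him⟩
    refine ⟨⟨by omega, hj⟩, ⟨⟨by omega, hj⟩, ?_⟩, ?_, h3⟩
    · intro k hk
      refine lt_of_le_of_ne ?_ ?_
      · rw [Fin.le_def, h3]
        have := (σ ⟨k, by omega⟩).isLt
        omega
      · intro he
        have := congrArg Fin.val (σ.injective he)
        simp at this
        omega
    · rintro m hm hmj ⟨hm', hr⟩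
      simp only [Fin.lt_def] at hi
      have h1 := hr i (by omega)
      have h2 := him ⟨m - 1, by omega⟩ (by simp [Fin.lt_def]; omega)
      exact absurd h1 (not_lt.2 h2)

lemma secE_card (N l j : ℕ) (hl : 2 ≤ l) (hlj : l ≤ j) (hj : j ≤ N) :
    ((secE N l j).card : ℝ) / N.factorial = ((l : ℝ) - 1) / ((N : ℝ) * ((j : ℝ) - 1)) := by
  have hi0 : (⟨0, by omega⟩ : Fin N) < ⟨j - 1, by omega⟩ := by simp [Fin.lt_def]; omega
  have hB := secB_card _ _ hi0
  have hA := secA_card (⟨j - 1, by omega⟩ : Fin N)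
  have hsub : ∀ i ∈ Iio (⟨l - 1, by omega⟩ : Fin N), i < (⟨j - 1, by omega⟩ : Fin N) := by
    intro i hi
    simp only [mem_Iio, Fin.lt_def] at hi ⊢
    omega
  have hE := secB_disj _ _ hsub
  rw [← secE_eq N l j hl hlj hj, sum_congr rfl (fun s hs =>
    le_antisymm (secB_card_le _ s _ (hsub s hs) hi0)
      (secB_card_le _ _ s hi0 (hsub s hs)))] at hE
  simp only [sum_const, Fin.card_Iio, smul_eq_mul] at hE
  rw [← hB] at hA
  have hj1 : ((j - 1 : ℕ) : ℝ) = (j : ℝ) - 1 := by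
    rw [Nat.cast_sub (by omega)]; simp
  have hl1 : ((l - 1 : ℕ) : ℝ) = (l : ℝ) - 1 := by
    rw [Nat.cast_sub (by omega)]; simp
  have hjpos : (0 : ℝ) < (j : ℝ) - 1 := by
    rw [← hj1]; exact_mod_cast (by omega : 0 < j - 1)
  have hNpos : (0 : ℝ) < N := by exact_mod_cast (by omega : 0 < N)
  have hfpos : (0 : ℝ) < N.factorial := by exact_mod_cast N.factorial_pos
  have hA' := congrArg (Nat.cast : ℕ → ℝ) hA
  simp only [Nat.cast_mul, hj1] at hA'
  rw [hE, div_eq_div_iff hfpos.ne' (by positivity), ← hA']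
  simp only [Nat.cast_mul, hl1]
  ring

lemma sec_main (N l : ℕ) (hl : 2 ≤ l)
    (k : ℕ) (hkN : k ≤ N) (P : Equiv.Perm (Fin N) → Prop)
    (hP : ∀ σ, P σ ↔ ∃ j, (l ≤ j ∧ j ≤ k) ∧ σ ∈ secE N l j) :
    (Nat.card {σ : Equiv.Perm (Fin N) // P σ} : ℝ) / (Nat.factorial N)
      = ∑ j ∈ Finset.Icc l k, ((l : ℝ) - 1) / ((N : ℝ) * ((j : ℝ) - 1)) := by
  have hU : ((Icc l k).biUnion (secE N l)).card = ∑ j ∈ Icc l k, (secE N l j).card := by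
    apply card_biUnion
    intro a ha b hb hab
    rw [Function.onFun, Finset.disjoint_left]
    intro σ h1 h2
    simp only [secE, mem_filter, mem_univ, true_and] at h1 h2
    obtain ⟨ha', _, _, h1⟩ := h1
    obtain ⟨hb', _, _, h2⟩ := h2
    have := congrArg Fin.val (σ.injective (Fin.ext (h1.trans h2.symm)))
    simp at this
    omega
  rw [Nat.card_eq_fintype_card, Fintype.card_subtype]
  have hS : (univ.filter fun σ : Equiv.Perm (Fin N) => P σ) = (Icc l k).biUnion (secE N l) := by
    ext σ
    simp only [mem_biUnion, mem_Icc, mem_filter, mem_univ, true_and]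
    exact hP σ
  rw [hS, hU, Nat.cast_sum, sum_div]
  apply sum_congr rfl
  intro j hj
  rw [mem_Icc] at hj
  exact secE_card N l j hl hj.1 (hj.2.trans hkN)

end Aux

/-- for `2 ≤ l ≤ N`, the threshold rule `τ(l)` is the smallest
`j ≥ l` at which `σ` has a record.  For every `l ≤ k ≤ N`, the probability that
`τ(l)` is defined, `τ(l) ≤ k`, and `σ(τ(l)) = N` (the rule picks the maximum,
i.e. the value at position `τ(l)` is the top value `N`, encoded as the `Fin N`
value `N - 1`) equals `Σ_{j=l}^{k} (l−1)/(N(j−1))`; in particular (`k = N`) the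
probability that the threshold-`l` rule selects the maximum is
`((l−1)/N) Σ_{j=l}^{N} 1/(j−1)`.  Probabilities of events are
`(number of permutations in the event) / N!`. -/
theorem stmt12 (N l : ℕ) (hl : 2 ≤ l) (hlN : l ≤ N)
    (k : ℕ) (hlk : l ≤ k) (hkN : k ≤ N) :
    ((Nat.card {σ : Equiv.Perm (Fin N) //
        ∃ j, ∃ hlj : l ≤ j, ∃ hjk : j ≤ k,
          RecordAt σ j ∧ (∀ m, l ≤ m → m < j → ¬ RecordAt σ m) ∧
          ((σ ⟨j - 1, by omega⟩ : ℕ) = N - 1)} : ℝ) / (Nat.factorial N)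
      = ∑ j ∈ Finset.Icc l k, ((l : ℝ) - 1) / ((N : ℝ) * ((j : ℝ) - 1))) ∧
    ((Nat.card {σ : Equiv.Perm (Fin N) //
        ∃ j, ∃ hlj : l ≤ j, ∃ hjN' : j ≤ N,
          RecordAt σ j ∧ (∀ m, l ≤ m → m < j → ¬ RecordAt σ m) ∧
          ((σ ⟨j - 1, by omega⟩ : ℕ) = N - 1)} : ℝ) / (Nat.factorial N)
      = (((l : ℝ) - 1) / (N : ℝ)) * ∑ j ∈ Finset.Icc l N, 1 / ((j : ℝ) - 1)) := by
  constructor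
  · apply sec_main N l hl k hkN
    intro σ
    simp only [secE, Finset.mem_filter, Finset.mem_univ, true_and]
    constructor
    · rintro ⟨j, h1, h2, h⟩
      exact ⟨j, ⟨h1, h2⟩, ⟨by omega, by omega⟩, h⟩
    · rintro ⟨j, ⟨h1, h2⟩, _, h⟩
      exact ⟨j, h1, h2, h⟩
  · rw [sec_main N l hl N le_rfl, Finset.mul_sum]
    · apply Finset.sum_congr rfl
      intro j _
      rw [div_mul_div_comm, mul_one]
    · intro σ
      simp only [secE, Finset.mem_filter, Finset.mem_univ, true_and]
      constructor
      · rintro ⟨j, h1, h2, h⟩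
        exact ⟨j, ⟨h1, h2⟩, ⟨by omega, by omega⟩, h⟩
      · rintro ⟨j, ⟨h1, h2⟩, _, h⟩
        exact ⟨j, h1, h2, h⟩
end

section
/- For every n with 1 ≤ n ≤ N, the conditional probability that σ(n) = N given that σ has a record at time n equals n/N. -/
/-- Exactly a `1 / |S|` proportion of the permutations attain their maximum over `S` at `m`. -/
lemma card_max_at {α : Type*} [Fintype α] [LinearOrder α] (S : Finset α) (m : α) (hm : m ∈ S) :
    S.card * Nat.card {σ : Equiv.Perm α // ∀ k ∈ S, σ k ≤ σ m} = Nat.card (Equiv.Perm α) := by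
  have hS : S.card = Nat.card {j // j ∈ S} := by simp
  rw [hS, ← Nat.card_prod]
  have hsw : ∀ j ∈ S, ∀ k ∈ S, Equiv.swap j m k ∈ S := by
    intro j hj k hk
    rw [Equiv.swap_apply_def]
    split_ifs <;> assumption
  refine Nat.card_congr (Equiv.ofBijective
    (fun p : {j // j ∈ S} × {σ : Equiv.Perm α // ∀ k ∈ S, σ k ≤ σ m} =>
      p.2.1 * Equiv.swap p.1.1 m) ⟨?_, ?_⟩)
  · rintro ⟨⟨j, hj⟩, ⟨σ, hσ⟩⟩ ⟨⟨i, hi⟩, ⟨τ, hτ⟩⟩ h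
    simp only at h
    have key : j = i := by
      have h1 := hτ _ (hsw i hi j hj)
      have h2 := hσ _ (hsw j hj i hi)
      have e1 : σ m = τ (Equiv.swap i m j) := by
        simpa using congrArg (fun f : Equiv.Perm α => f j) h
      have e2 : σ (Equiv.swap j m i) = τ m := by
        simpa using congrArg (fun f : Equiv.Perm α => f i) h
      rw [← e1] at h1
      rw [e2] at h2
      have e3 : σ (Equiv.swap j m i) = σ m := e2.trans (le_antisymm h2 h1)
      have e4 := σ.injective e3
      have e5 : Equiv.swap j m i = Equiv.swap j m j := by rw [e4]; simp
      exact ((Equiv.swap j m).injective e5).symm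
    subst key
    have := mul_right_cancel h
    subst this
    rfl
  · intro σ
    obtain ⟨j, hj, hmax⟩ := S.exists_max_image σ ⟨m, hm⟩
    refine ⟨⟨⟨j, hj⟩, ⟨σ * Equiv.swap j m, ?_⟩⟩, ?_⟩
    · intro k hk
      simpa using hmax _ (hsw j hj k hk)
    · simp [mul_assoc]

theorem stmt13 (N n : ℕ) (hn : 1 ≤ n) (hnN : n ≤ N) :
    (Nat.card {σ : Equiv.Perm (Fin N) //
        RecordAt σ n ∧ ((σ ⟨n - 1, by omega⟩ : ℕ) = N - 1)} : ℝ)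
      / (Nat.card {σ : Equiv.Perm (Fin N) // RecordAt σ n} : ℝ)
      = (n : ℝ) / (N : ℝ) := by
  have hlt : n - 1 < N := by omega
  have hrec : ∀ σ : Equiv.Perm (Fin N), RecordAt σ n ↔
      ∀ k ∈ Finset.Iic (⟨n - 1, hlt⟩ : Fin N), σ k ≤ σ ⟨n - 1, hlt⟩ := by
    intro σ
    constructor
    · rintro ⟨_, h⟩ k hk
      rw [Finset.mem_Iic] at hk
      rcases hk.lt_or_eq with h1 | h1
      · exact (h k.1 h1).le
      · rw [h1]
    · intro h
      refine ⟨⟨hn, hnN⟩, fun k hk => lt_of_le_of_ne (h _ ?_) ?_⟩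
      · rw [Finset.mem_Iic]
        exact (show k ≤ n - 1 from hk.le)
      · intro e
        have := congrArg Fin.val (σ.injective e)
        simp only at this
        omega
  have htop : ∀ σ : Equiv.Perm (Fin N),
      (RecordAt σ n ∧ ((σ ⟨n - 1, hlt⟩ : ℕ) = N - 1)) ↔
      ∀ k ∈ (Finset.univ : Finset (Fin N)), σ k ≤ σ ⟨n - 1, hlt⟩ := by
    intro σ
    constructor
    · rintro ⟨_, h⟩ k _
      rw [Fin.le_def, h]
      have := (σ k).2
      omega
    · intro h
      refine ⟨(hrec σ).2 fun k _ => h k (Finset.mem_univ k), ?_⟩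
      have h1 := h (σ.symm ⟨N - 1, by omega⟩) (Finset.mem_univ _)
      rw [Equiv.apply_symm_apply, Fin.le_def] at h1
      have := (σ ⟨n - 1, hlt⟩).2
      simp only at h1
      omega
  have c1 := card_max_at (Finset.Iic (⟨n - 1, hlt⟩ : Fin N)) ⟨n - 1, hlt⟩ (by simp)
  have c2 := card_max_at (Finset.univ : Finset (Fin N)) ⟨n - 1, hlt⟩ (by simp)
  rw [← Nat.card_congr (Equiv.subtypeEquivRight hrec), Fin.card_Iic] at c1
  rw [← Nat.card_congr (Equiv.subtypeEquivRight htop), Finset.card_univ, Fintype.card_fin] at c2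
  have hn1 : n - 1 + 1 = n := by omega
  simp only [hn1] at c1
  have hpos : 0 < Nat.card (Equiv.Perm (Fin N)) := Nat.card_pos
  have hR : (Nat.card {σ : Equiv.Perm (Fin N) // RecordAt σ n} : ℝ) ≠ 0 := by
    intro h
    have h' := Nat.cast_eq_zero.1 h
    rw [h'] at c1
    omega
  have hN : (N : ℝ) ≠ 0 := by
    have : N ≠ 0 := by omega
    exact_mod_cast this
  rw [div_eq_div_iff hR hN]
  have := c2.trans c1.symm
  rw [mul_comm]
  exact_mod_cast this
end

section
/- For every real β ≥ 1/2, the function G_β : (0,1) → ℝ defined by G_β(z) = β(4z ln z + 2z²(ln z)² + 2z² ln z + z³(ln z)² + 2z³ ln z + 5z − z³ − z⁴) + (2z + 2z² ln z + 2z²(1−z)² + 2z³(ln z)² + 3z³ ln z + 10z³ − z⁴ + z⁵) has exactly one zero in the open interval (0,1). -/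
theorem aux_log (z : ℝ) (h0 : 0 < z) : ∃ s : ℝ, 0 < s ∧ z = s ^ 2 ∧ 2 * (1 - 1 / s) ≤ Real.log z := by
  refine ⟨Real.sqrt z, Real.sqrt_pos.2 h0, (Real.sq_sqrt h0.le).symm, ?_⟩
  have h := Real.one_sub_inv_le_log_of_pos (Real.sqrt_pos.2 h0)
  rw [Real.log_sqrt h0.le] at h
  rw [one_div]; linarith

theorem aux_A (z : ℝ) (h0 : 0 < z) (h1 : z < 1) :
    0 < 4 / z + 2 * (1 + z) * (Real.log z ^ 2 + 3 * Real.log z) + 2 - 3 * z ^ 2 := by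
  obtain ⟨s, hs, hz, hl⟩ := aux_log z h0
  have hs1 : s < 1 := by nlinarith
  have hp : 0 < (4 - 12 * s + 14 * s ^ 2 - 12 * s ^ 3 + 12 * s ^ 4 - 3 * s ^ 6) / s ^ 2 := by
    apply div_pos _ (by positivity)
    have h6 : s ^ 6 ≤ s ^ 4 := pow_le_pow_of_le_one hs.le hs1.le (by norm_num)
    nlinarith [sq_nonneg (3 * s ^ 2 - 2 * s + 0), sq_nonneg (s ^ 2 - 2/3 * s), sq_nonneg (s - 0.65), sq_nonneg (s^2 - 0.65*s), sq_nonneg (s^2-0.42)]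
  have e : (4 - 12 * s + 14 * s ^ 2 - 12 * s ^ 3 + 12 * s ^ 4 - 3 * s ^ 6) / s ^ 2
      = 4 / s ^ 2 + 6 * (1 + s ^ 2) * (2 * (1 - 1 / s)) + 2 - 3 * (s ^ 2) ^ 2 := by
    field_simp; ring
  rw [e, ← hz] at hp
  have := mul_le_mul_of_nonneg_left hl (by positivity : 0 ≤ 6 * (1 + z))
  have := mul_nonneg (by positivity : 0 ≤ 2 * (1 + z)) (sq_nonneg (Real.log z))
  nlinarith

theorem aux_B (z : ℝ) (h0 : 0 < z) :
    0 < 2 / z + 5 + 15 * z + 3 / 2 * z ^ 2 + 4 * z ^ 3 + Real.log z ^ 2 * (1 + 5 * z)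
      + Real.log z * (5 + 13 * z) := by
  obtain ⟨s, hs, hz, hl⟩ := aux_log z h0
  have hp : 0 < (2 - 6 * s + 10 * s ^ 2 - 6 * s ^ 3 + 16 * s ^ 4) / s ^ 2 := by
    apply div_pos _ (by positivity)
    nlinarith [sq_nonneg (s - 0.4), sq_nonneg (s ^ 2 - 0.4 * s), sq_nonneg (s ^ 2)]
  have e : (2 - 6 * s + 10 * s ^ 2 - 6 * s ^ 3 + 16 * s ^ 4) / s ^ 2
      = 2 / s ^ 2 + 4 + 10 * s ^ 2 + 3 * (1 + s ^ 2) * (2 * (1 - 1 / s)) := by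
    field_simp; ring
  rw [e, ← hz] at hp
  have := mul_le_mul_of_nonneg_left hl (by positivity : 0 ≤ 3 * (1 + z))
  have := mul_nonneg (by positivity : 0 ≤ 1 + 5 * z) (sq_nonneg (Real.log z + 1))
  have : 0 ≤ 3 / 2 * z ^ 2 + 4 * z ^ 3 := by positivity
  nlinarith

/-- `G z / z`. -/
noncomputable def auxH (β z : ℝ) : ℝ :=
  β * (4 * Real.log z + (2 * z + z ^ 2) * Real.log z ^ 2 + (2 * z + 2 * z ^ 2) * Real.log z
      + 5 - z ^ 2 - z ^ 3)
    + (2 + 2 * z * (1 - z) ^ 2 + 2 * z ^ 2 * Real.log z ^ 2 + (2 * z + 3 * z ^ 2) * Real.log z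
      + 10 * z ^ 2 - z ^ 3 + z ^ 4)

theorem auxH_cont (β : ℝ) : ContinuousOn (auxH β) (Set.Ioc 0 1) := by
  have hl : ContinuousOn Real.log (Set.Ioc 0 1) :=
    Real.continuousOn_log.mono (fun x hx => by simpa using hx.1.ne')
  unfold auxH
  fun_prop

theorem auxH_deriv (β z : ℝ) (h0 : 0 < z) : HasDerivAt (auxH β)
    ((β - 1 / 2) * (4 / z + 2 * (1 + z) * (Real.log z ^ 2 + 3 * Real.log z) + 2 - 3 * z ^ 2)
      + (2 / z + 5 + 15 * z + 3 / 2 * z ^ 2 + 4 * z ^ 3 + Real.log z ^ 2 * (1 + 5 * z)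
      + Real.log z * (5 + 13 * z))) z := by
  have hl := Real.hasDerivAt_log h0.ne'
  have hx := hasDerivAt_id' z
  have hA := (((((hl.const_mul 4).add (((hx.const_mul 2).add (hx.pow 2)).mul (hl.pow 2))).add
    (((hx.const_mul 2).add ((hx.pow 2).const_mul 2)).mul hl)).add_const 5).sub (hx.pow 2)).sub
    (hx.pow 3)
  have hB := ((((((((hx.const_mul 2).mul ((hx.const_sub 1).pow 2)).const_add 2).add
    (((hx.pow 2).const_mul 2).mul (hl.pow 2))).add
    (((hx.const_mul 2).add ((hx.pow 2).const_mul 3)).mul hl)).add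
    ((hx.pow 2).const_mul 10)).sub (hx.pow 3)).add (hx.pow 4))
  have h := (hA.const_mul β).add hB
  refine h.congr_deriv ?_
  simp
  field_simp
  ring

theorem auxH_mono (β : ℝ) (hβ : 1 / 2 ≤ β) : StrictMonoOn (auxH β) (Set.Ioc 0 1) := by
  refine strictMonoOn_of_deriv_pos (convex_Ioc 0 1) (auxH_cont β) ?_
  intro z hz
  rw [interior_Ioc] at hz
  rw [(auxH_deriv β z hz.1).deriv]
  have := mul_nonneg (sub_nonneg.2 hβ) (aux_A z hz.1 hz.2).le
  have := aux_B z hz.1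
  linarith

theorem auxH_neg (β : ℝ) (hβ : 1 / 2 ≤ β) : ∃ z ∈ Set.Ioo (0 : ℝ) 1, auxH β z < 0 := by
  have hpos := Real.exp_pos (-3)
  have hlt : Real.exp (-3) < 1 / 10 := by
    have h := Real.exp_one_gt_d9
    have h3 : Real.exp 3 = Real.exp 1 ^ 3 := by rw [← Real.exp_nat_mul]; norm_num
    have : (2.7 : ℝ) ^ 3 < Real.exp 3 := by
      rw [h3]; exact pow_lt_pow_left₀ (by linarith) (by norm_num) (by norm_num)
    rw [Real.exp_neg, ← one_div]
    exact one_div_lt_one_div_of_lt (by norm_num) (by norm_num at this; linarith)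
  refine ⟨Real.exp (-3), ⟨hpos, by linarith⟩, ?_⟩
  unfold auxH
  rw [Real.log_exp]
  generalize Real.exp (-3) = z at *
  have h2 : z ^ 2 < z / 10 := by nlinarith
  have h2' : 0 < z ^ 2 := by positivity
  have h3 : 0 < z ^ 3 := by positivity
  have h4 : z ^ 4 < z ^ 2 := by nlinarith
  have hA : 4 * (-3) + (2 * z + z ^ 2) * (-3) ^ 2 + (2 * z + 2 * z ^ 2) * (-3)
      + 5 - z ^ 2 - z ^ 3 < -5 := by nlinarith
  have hB : 2 + 2 * z * (1 - z) ^ 2 + 2 * z ^ 2 * (-3) ^ 2 + (2 * z + 3 * z ^ 2) * (-3)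
      + 10 * z ^ 2 - z ^ 3 + z ^ 4 < 5 / 2 := by nlinarith
  nlinarith

/-- for every `β ≥ 1/2`, the function
`G_β(z) = β(4z ln z + 2z²(ln z)² + 2z² ln z + z³(ln z)² + 2z³ ln z + 5z − z³ − z⁴)
        + (2z + 2z² ln z + 2z²(1−z)² + 2z³(ln z)² + 3z³ ln z + 10z³ − z⁴ + z⁵)`
(the universal transcendental equation (Y3.1) of the bivariant model, with
`β = 4c_α/α`) has exactly one zero in the open interval `(0,1)`. -/
theorem stmt18 (β : ℝ) (hβ : 1 / 2 ≤ β) (G : ℝ → ℝ)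
    (hG : ∀ z : ℝ, G z =
      β * (4 * z * Real.log z + 2 * z ^ 2 * (Real.log z) ^ 2 + 2 * z ^ 2 * Real.log z
          + z ^ 3 * (Real.log z) ^ 2 + 2 * z ^ 3 * Real.log z + 5 * z - z ^ 3 - z ^ 4)
        + (2 * z + 2 * z ^ 2 * Real.log z + 2 * z ^ 2 * (1 - z) ^ 2
          + 2 * z ^ 3 * (Real.log z) ^ 2 + 3 * z ^ 3 * Real.log z
          + 10 * z ^ 3 - z ^ 4 + z ^ 5)) :
    ∃! z : ℝ, z ∈ Set.Ioo (0 : ℝ) 1 ∧ G z = 0 := by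
  have key : ∀ z, G z = z * auxH β z := by
    intro z; rw [hG]; unfold auxH; ring
  obtain ⟨a, ha, han⟩ := auxH_neg β hβ
  have h1 : 0 < auxH β 1 := by
    unfold auxH; norm_num; linarith
  have hsub : Set.Icc a 1 ⊆ Set.Ioc 0 1 := fun x hx => ⟨ha.1.trans_le hx.1, hx.2⟩
  obtain ⟨z, hz, hz0⟩ := intermediate_value_Ioo ha.2.le ((auxH_cont β).mono hsub) ⟨han, h1⟩
  have hzp : 0 < z := ha.1.trans hz.1
  refine ⟨z, ⟨⟨hzp, hz.2⟩, by rw [key, hz0, mul_zero]⟩, ?_⟩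
  rintro y ⟨hy, hy0⟩
  rw [key] at hy0
  have hy' : auxH β y = 0 := (mul_eq_zero.1 hy0).resolve_left hy.1.ne'
  exact (auxH_mono β hβ).injOn ⟨hy.1, hy.2.le⟩ ⟨hzp, hz.2.le⟩ (hy'.trans hz0.symm)
end
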